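/- arXiv:2210.06279 — 5 statements merged into one kernel-verified Lean document; each statement's English description precedes it below -/
import Mathlib

section
/- Let L be a finite complemented modular lattice with Möbius function μ, bottom element ⊥ and top element ⊤, and let Z be the number of elements h ∈ L satisfying the distributive law h ∨ (k₁ ∧ k₂) = (h ∨ k₁) ∧ (h ∨ k₂) for all k₁, k₂ ∈ L. Then ∑_{x ∈ L} |μ(x,⊤)| ≤ |μ(⊥,⊤)| · Z³. -/
/-- `μ` is the Möbius function of the lattice `L`: `μ(x,x) = 1` and
`∑_{x ≤ z ≤ y} μ(x,z) = 0` whenever `x < y`. -/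
def IsMobiusFn {L : Type*} [PartialOrder L] (μ : L → L → ℝ) : Prop :=
  (∀ x : L, μ x x = 1) ∧ ∀ x y : L, x < y → ∑ᶠ z ∈ Set.Icc x y, μ x z = 0

set_option linter.unusedSectionVars false

namespace S13

open Classical

section atoms
variable {L : Type*} [Lattice L] [BoundedOrder L] [Fintype L] [IsModularLattice L]

lemma exists_atom {x : L} (hx : x ≠ ⊥) : ∃ a, IsAtom a ∧ a ≤ x := by
  rcases IsAtomic.eq_bot_or_exists_atom_le x with h | ⟨a, ha, hax⟩
  · exact absurd h hx
  · exact ⟨a, ha, hax⟩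

lemma atom_inf {a x : L} (ha : IsAtom a) (h : ¬ a ≤ x) : a ⊓ x = ⊥ :=
  (ha.le_iff.1 inf_le_left).resolve_right (fun h' => h (inf_eq_left.1 h'))

lemma le_of_atoms [ComplementedLattice L] {x y : L} (h : ∀ a, IsAtom a → a ≤ x → a ≤ y) :
    x ≤ y := by
  obtain ⟨c, hc⟩ := exists_isCompl (x ⊓ y)
  have h1 : (x ⊓ y) ⊔ (c ⊓ x) = x := by
    rw [← sup_inf_assoc_of_le c (inf_le_left : x ⊓ y ≤ x), hc.sup_eq_top, top_inf_eq]
  by_cases hd : c ⊓ x = ⊥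
  · rw [hd, sup_bot_eq] at h1
    exact inf_eq_left.1 h1
  · obtain ⟨a, ha, hac⟩ := exists_atom hd
    have h2 : a ≤ (x ⊓ y) ⊓ c :=
      le_inf (le_inf (hac.trans inf_le_right) (h a ha (hac.trans inf_le_right)))
        (hac.trans inf_le_left)
    rw [hc.inf_eq_bot] at h2
    exact absurd (le_bot_iff.1 h2) ha.1

/-- covering: an atom not below `x` joined with `x` covers `x` -/
lemma atom_covBy {a x : L} (ha : IsAtom a) (h : ¬ a ≤ x) : x ⋖ x ⊔ a := by
  refine ⟨lt_of_le_of_ne le_sup_left (fun e => h (e ▸ le_sup_right)), ?_⟩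
  intro w hw1 hw2
  have h1 : x ⊔ (a ⊓ w) = w := by
    rw [← sup_inf_assoc_of_le a hw1.le, inf_eq_right.2 hw2.le]
  by_cases haw : a ≤ w
  · exact absurd (sup_le hw1.le haw) (not_le_of_gt hw2)
  · rw [atom_inf ha haw, sup_bot_eq] at h1
    exact absurd h1 hw1.ne

lemma exch {a x b : L} (ha : IsAtom a) (hb : IsAtom b) (hax : ¬ a ≤ x) (h : a ≤ x ⊔ b) :
    x ⊔ a = x ⊔ b := by
  have hbx : ¬ b ≤ x := fun hb' => hax (by rwa [sup_eq_left.2 hb'] at h)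
  have h1 := atom_covBy hb hbx
  have h2 := atom_covBy ha hax
  exact (h1.eq_or_eq h2.le (sup_le le_sup_left h)).resolve_left h2.ne'

lemma atom_ne_le {a b : L} (ha : IsAtom a) (hb : IsAtom b) (h : a ≠ b) : ¬ a ≤ b := by
  intro h'
  rcases hb.le_iff.1 h' with h1 | h1
  · exact ha.1 h1
  · exact h h1

lemma third {a c h : L} (ha : IsAtom a) (hc : IsAtom c) (hac : a ≠ c) (h1 : ¬ a ≤ h)
    (h2 : ¬ c ≤ h) (h3 : h ⊔ a = h ⊔ c) : ∃ p, IsAtom p ∧ p ≤ a ⊔ c ∧ p ≠ a ∧ p ≠ c ∧ p ≤ h := by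
  have hr : h ⊓ (a ⊔ c) ≠ ⊥ := by
    intro hr
    have : a ⊔ (h ⊓ (a ⊔ c)) = a ⊔ c := by
      rw [← sup_inf_assoc_of_le h (le_sup_left : a ≤ a ⊔ c), sup_comm a h, h3]
      exact inf_eq_right.2 (sup_le (h3 ▸ le_sup_right) le_sup_right)
    rw [hr, sup_bot_eq] at this
    exact atom_ne_le hc ha hac.symm (this ▸ le_sup_right)
  obtain ⟨p, hp, hpr⟩ := exists_atom hr
  refine ⟨p, hp, hpr.trans inf_le_right, ?_, ?_, hpr.trans inf_le_left⟩
  · rintro rfl; exact h1 (hpr.trans inf_le_left)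
  · rintro rfl; exact h2 (hpr.trans inf_le_left)

/-- perspectivity of atoms -/
def R (a b : L) : Prop := IsAtom a ∧ IsAtom b ∧
  (a = b ∨ ∃ p, IsAtom p ∧ p ≤ a ⊔ b ∧ p ≠ a ∧ p ≠ b)

lemma R_of {a c h : L} (ha : IsAtom a) (hc : IsAtom c) (h1 : ¬ a ≤ h)
    (h2 : ¬ c ≤ h) (h3 : h ⊔ a = h ⊔ c) : R a c := by
  refine ⟨ha, hc, ?_⟩
  by_cases hac : a = c
  · exact Or.inl hac
  · obtain ⟨p, hp, hp1, hp2, hp3, -⟩ := third ha hc hac h1 h2 h3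
    exact Or.inr ⟨p, hp, hp1, hp2, hp3⟩

lemma R_refl {a : L} (ha : IsAtom a) : R a a := ⟨ha, ha, Or.inl rfl⟩

lemma R_symm {a b : L} (h : R a b) : R b a := by
  obtain ⟨ha, hb, h⟩ := h
  refine ⟨hb, ha, ?_⟩
  rcases h with h | ⟨p, hp, h1, h2, h3⟩
  · exact Or.inl h.symm
  · exact Or.inr ⟨p, hp, by rwa [sup_comm], h3, h2⟩

lemma line {a b p : L} (ha : IsAtom a) (hb : IsAtom b) (hp : IsAtom p) (h1 : p ≤ a ⊔ b)
    (h2 : p ≠ a) : a ⊔ p = a ⊔ b :=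
  exch hp hb (atom_ne_le hp ha h2) h1

lemma R_trans {a b c : L} (h : R a b) (h' : R b c) : R a c := by
  obtain ⟨ha, hb, h⟩ := h
  obtain ⟨-, hc, h'⟩ := h'
  rcases h with rfl | ⟨p, hp, hp1, hp2, hp3⟩
  · exact ⟨ha, hc, h'⟩
  rcases h' with rfl | ⟨q, hq, hq1, hq2, hq3⟩
  · exact ⟨ha, hb, Or.inr ⟨p, hp, hp1, hp2, hp3⟩⟩
  by_cases hac : a = c
  · exact hac ▸ R_refl ha
  by_cases hab : a = b
  · subst hab; exact ⟨ha, hc, Or.inr ⟨q, hq, hq1, hq2, hq3⟩⟩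
  by_cases hbc : b = c
  · subst hbc; exact ⟨ha, hb, Or.inr ⟨p, hp, hp1, hp2, hp3⟩⟩
  by_cases hcol : c ≤ a ⊔ b
  · refine ⟨ha, hc, Or.inr ⟨b, hb, ?_, Ne.symm hab, hbc⟩⟩
    have := line ha hb hc hcol (Ne.symm hac)
    rw [this]; exact le_sup_right
  -- line equalities
  have eap : a ⊔ p = a ⊔ b := line ha hb hp hp1 hp2
  have ebp : b ⊔ p = b ⊔ a := line hb ha hp (by rwa [sup_comm]) hp3
  have ebq : b ⊔ q = b ⊔ c := line hb hc hq hq1 hq2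
  have ecq : c ⊔ q = c ⊔ b := line hc hb hq (by rwa [sup_comm]) hq3
  have hqab : ¬ q ≤ a ⊔ b := fun hh => hcol (by
    have : b ⊔ c ≤ a ⊔ b := ebq ▸ sup_le le_sup_right hh
    exact le_sup_right.trans this)
  have hpq : p ≠ q := by rintro rfl; exact hqab hp1
  have hpbc : ¬ p ≤ b ⊔ c := fun hh => hcol (by
    have h1 := line hb hc hp hh hp3
    rw [ebp] at h1
    rw [sup_comm a b, h1]; exact le_sup_right)
  refine R_of (h := p ⊔ q) ha hc ?_ ?_ ?_
  · intro hh
    have := exch ha hq (atom_ne_le ha hp (Ne.symm hp2)) hh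
    apply hqab
    rw [← eap, sup_comm a p, this]; exact le_sup_right
  · intro hh
    rw [sup_comm] at hh
    have := exch hc hp (atom_ne_le hc hq (Ne.symm hq3)) hh
    apply hpbc
    rw [sup_comm b c, ← ecq, sup_comm c q, this]; exact le_sup_right
  · apply le_antisymm
    · refine sup_le le_sup_left ?_
      have h1 : b ≤ p ⊔ q ⊔ c := by
        have : b ≤ c ⊔ q := ecq ▸ le_sup_right
        exact this.trans (sup_le le_sup_right (le_sup_right.trans le_sup_left))
      have : a ≤ b ⊔ p := ebp ▸ le_sup_right
      exact this.trans (sup_le h1 (le_sup_left.trans le_sup_left))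
    · refine sup_le le_sup_left ?_
      have h1 : b ≤ p ⊔ q ⊔ a := by
        have : b ≤ a ⊔ p := eap ▸ le_sup_right
        exact this.trans (sup_le le_sup_right (le_sup_left.trans le_sup_left))
      have : c ≤ b ⊔ q := ebq ▸ le_sup_right
      exact this.trans (sup_le h1 (le_sup_right.trans le_sup_left))

/-- perspectivity class -/
def cl (a : L) : Set L := {b | R a b}

lemma cl_eq {a b : L} (h : R a b) : cl a = cl b := by
  ext c
  exact ⟨fun h' => R_trans (R_symm h) h', fun h' => R_trans h h'⟩

lemma R_of_cl {a b : L} (hb : IsAtom b) (h : cl a = cl b) : R a b := by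
  have : b ∈ cl b := R_refl hb
  rw [← h] at this
  exact this

/-- classes meeting `h` -/
noncomputable def D (h : L) : Finset (Set L) :=
  (Finset.univ.filter (fun a : L => IsAtom a ∧ a ≤ h)).image cl

lemma mem_D {h : L} {C : Set L} : C ∈ D h ↔ ∃ a, IsAtom a ∧ a ≤ h ∧ cl a = C := by
  simp [D, and_assoc]

lemma D_mono {h h' : L} (hh : h' ≤ h) : D h' ⊆ D h := by
  intro C hC
  obtain ⟨a, ha, h1, h2⟩ := mem_D.1 hC
  exact mem_D.2 ⟨a, ha, h1.trans hh, h2⟩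

/-! ### central elements -/
noncomputable def e (S : Finset (Set L)) : L :=
  (Finset.univ.filter (fun a : L => IsAtom a ∧ cl a ∈ S)).sup id

lemma sep_aux (S : Finset (Set L)) (T : Finset L) (hT : ∀ b ∈ T, IsAtom b ∧ cl b ∈ S)
    {a k : L} (ha : IsAtom a) (haS : cl a ∉ S) (h : a ≤ k ⊔ T.sup id) : a ≤ k := by
  induction T using Finset.induction_on with
  | empty => simpa using h
  | insert b T hb ih =>
    by_cases h1 : a ≤ k ⊔ T.sup id
    · exact ih (fun b hb => hT b (Finset.mem_insert_of_mem hb)) h1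
    · exfalso
      obtain ⟨hb1, hb2⟩ := hT b (Finset.mem_insert_self _ _)
      rw [Finset.sup_insert, id, sup_comm b, ← sup_assoc] at h
      have h2 := exch ha hb1 h1 h
      have h3 : ¬ b ≤ k ⊔ T.sup id := fun h3 => h1 (by rwa [sup_eq_left.2 h3] at h)
      exact haS (cl_eq (R_of ha hb1 h1 h3 h2) ▸ hb2)

lemma sep {S : Finset (Set L)} {a k : L} (ha : IsAtom a) (haS : cl a ∉ S) (h : a ≤ e S ⊔ k) :
    a ≤ k := by
  rw [sup_comm] at h
  exact sep_aux S _ (fun b hb => by simpa using hb) ha haS h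

lemma le_e {S : Finset (Set L)} {a : L} (ha : IsAtom a) (haS : cl a ∈ S) : a ≤ e S :=
  Finset.le_sup (f := id) (by simp [ha, haS])

lemma e_neutral [ComplementedLattice L] (S : Finset (Set L)) (k₁ k₂ : L) :
    e S ⊔ (k₁ ⊓ k₂) = (e S ⊔ k₁) ⊓ (e S ⊔ k₂) := by
  apply le_antisymm
  · exact le_inf (sup_le_sup_left inf_le_left _) (sup_le_sup_left inf_le_right _)
  · apply le_of_atoms
    intro a ha h
    by_cases haS : cl a ∈ S
    · exact (le_e ha haS).trans le_sup_left
    · exact (le_inf (sep ha haS (h.trans inf_le_left))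
        (sep ha haS (h.trans inf_le_right))).trans le_sup_right

lemma e_inj_aux {S T : Finset (Set L)} (hS : S ⊆ D ⊤) (h : e S ≤ e T) : S ⊆ T := by
  intro C hC
  obtain ⟨a, ha, -, rfl⟩ := mem_D.1 (hS hC)
  by_contra hT
  have := sep (k := ⊥) ha hT (by rw [sup_bot_eq]; exact (le_e ha hC).trans h)
  exact ha.1 (le_bot_iff.1 this)

lemma card_Z [ComplementedLattice L] : 2 ^ (D (⊤ : L)).card ≤
    Nat.card {h : L // ∀ k₁ k₂ : L, h ⊔ (k₁ ⊓ k₂) = (h ⊔ k₁) ⊓ (h ⊔ k₂)} := by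
  rw [← Finset.card_powerset, ← Nat.card_eq_finsetCard]
  refine Nat.card_le_card_of_injective
    (fun S : {S // S ∈ (D (⊤ : L)).powerset} => ⟨e S.1, e_neutral S.1⟩) ?_
  intro S T h
  have h : e S.1 = e T.1 := congrArg Subtype.val h
  exact Subtype.ext (Finset.Subset.antisymm
    (e_inj_aux (Finset.mem_powerset.1 S.2) h.le) (e_inj_aux (Finset.mem_powerset.1 T.2) h.ge))

/-! ### rank with respect to a class -/
inductive Q (C : Set L) : L → ℕ → Prop
  | bot : Q C ⊥ 0
  | step {z : L} {n : ℕ} {b : L} : Q C z n → b ∈ C → ¬ b ≤ z → Q C (z ⊔ b) (n + 1)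

lemma Q_bound {C : Set L} {z : L} {n : ℕ} (h : Q C z n) :
    n ≤ (Finset.univ.filter (fun w : L => w < z)).card := by
  induction h with
  | bot => simp
  | @step z n b h hb hbz ih =>
    refine Nat.succ_le_of_lt (lt_of_le_of_lt ih (Finset.card_lt_card ?_))
    have hlt : z < z ⊔ b := left_lt_sup.2 hbz
    rw [Finset.ssubset_iff_of_subset]
    · exact ⟨z, by simp [hbz], by simp⟩
    · intro w hw
      simp only [Finset.mem_filter, Finset.mem_univ, true_and] at hw ⊢
      exact hw.trans hlt

noncomputable def rk (C : Set L) (y : L) : ℕ := sSup {n | ∃ z ≤ y, Q C z n}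

lemma rk_bdd (C : Set L) (y : L) : BddAbove {n | ∃ z ≤ y, Q C z n} := by
  refine ⟨Fintype.card L, ?_⟩
  rintro n ⟨z, -, hz⟩
  exact (Q_bound hz).trans (Finset.card_le_univ _)

lemma rk_mem (C : Set L) (y : L) : ∃ z ≤ y, Q C z (rk C y) :=
  Nat.sSup_mem (s := {n | ∃ z ≤ y, Q C z n}) ⟨0, ⊥, bot_le, Q.bot⟩ (rk_bdd C y)

lemma rk_succ {C : Set L} {a x y : L} (ha : a ∈ C) (hay : ¬ a ≤ y) (hyx : y ≤ x) (hax : a ≤ x) :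
    rk C y + 1 ≤ rk C x := by
  obtain ⟨z, hz, hQ⟩ := rk_mem C y
  exact le_csSup (rk_bdd C x) ⟨z ⊔ a, sup_le (hz.trans hyx) hax,
    Q.step hQ ha (fun h => hay (h.trans hz))⟩

lemma Q_C {C : Set L} {z : L} {n : ℕ} (h : Q C z n) : n = 0 ∨ ∃ b ∈ C, b ≤ z := by
  cases h with
  | bot => exact Or.inl rfl
  | step h hb _ => exact Or.inr ⟨_, hb, le_sup_right⟩

end atoms

section count
variable {L : Type*} [Lattice L] [BoundedOrder L] [Fintype L] [IsModularLattice L]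

noncomputable def U (h h' w : L) : Finset L :=
  Finset.univ.filter (fun x => x ≤ h ∧ ¬ x ≤ h' ∧ x ⊓ h' = w)

lemma mem_U {h h' w x : L} : x ∈ U h h' w ↔ x ≤ h ∧ ¬ x ≤ h' ∧ x ⊓ h' = w := by
  simp [U]

lemma sup_cov {h h' x : L} (hc : h' ⋖ h) (hx : x ≤ h) (hx' : ¬ x ≤ h') : h' ⊔ x = h :=
  (hc.eq_or_eq le_sup_left (sup_le hc.le hx)).resolve_left (fun e => hx' (e ▸ le_sup_right))

lemma exists_off [ComplementedLattice L] {h' x : L} (hx' : ¬ x ≤ h') :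
    ∃ a, IsAtom a ∧ a ≤ x ∧ ¬ a ≤ h' := by
  by_contra hcon
  push Not at hcon
  exact hx' (le_of_atoms hcon)

/-- an element of U over y is the join of y with each of its atoms off the coatom -/
lemma U_eq {h h' y x a : L} (hc : h' ⋖ h) (hx : x ∈ U h h' y) (ha : IsAtom a) (hax : a ≤ x)
    (hah : ¬ a ≤ h') : y ⊔ a = x := by
  obtain ⟨h1, h2, h3⟩ := mem_U.1 hx
  have e1 : h' ⊔ a = h := sup_cov hc (hax.trans h1) hah
  have hyx : y ≤ x := h3 ▸ inf_le_left
  have := sup_inf_assoc_of_le h' hax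
  rw [sup_comm a h', e1, inf_eq_right.2 h1, inf_comm h' x, h3] at this
  rw [sup_comm]; exact this.symm

lemma mem_U_sup {h h' z a : L} (hc : h' ⋖ h) (hz : z ≤ h') (ha : IsAtom a) (hah : a ≤ h)
    (hah' : ¬ a ≤ h') : z ⊔ a ∈ U h h' z := by
  refine mem_U.2 ⟨sup_le (hz.trans hc.le) hah, fun hh => hah' (le_sup_right.trans hh), ?_⟩
  rw [sup_inf_assoc_of_le a hz, atom_inf ha hah', sup_bot_eq]

lemma U_card_mono [ComplementedLattice L] {h h' z y : L} (hc : h' ⋖ h) (hzy : z ≤ y)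
    (hy : y ≤ h') : (U h h' y).card ≤ (U h h' z).card := by
  refine (Finset.card_le_card (t := (U h h' z).image (fun x => y ⊔ x)) ?_).trans
    Finset.card_image_le
  intro x hx
  obtain ⟨h1, h2, h3⟩ := mem_U.1 hx
  obtain ⟨a, ha, hax, hah⟩ := exists_off h2
  refine Finset.mem_image.2 ⟨z ⊔ a, mem_U_sup hc (hzy.trans hy) ha (hax.trans h1) hah, ?_⟩
  rw [← sup_assoc, sup_eq_left.2 hzy]
  exact U_eq hc hx ha hax hah

lemma R_off {h h' a b : L} (hc : h' ⋖ h) (ha : IsAtom a) (hb : IsAtom b) (h1 : a ≤ h)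
    (h2 : b ≤ h) (h3 : ¬ a ≤ h') (h4 : ¬ b ≤ h') : R a b :=
  R_of ha hb h3 h4 ((sup_cov hc h1 h3).trans (sup_cov hc h2 h4).symm)

lemma U_card_step [ComplementedLattice L] {h h' z b a₀ : L} (hc : h' ⋖ h) (hz : z ≤ h')
    (hb : b ≤ h') (hbz : ¬ b ≤ z) (ha₀ : IsAtom a₀) (h1 : a₀ ≤ h) (h2 : ¬ a₀ ≤ h')
    (hR : R a₀ b) : 2 * (U h h' (z ⊔ b)).card ≤ (U h h' z).card := by
  have hy : z ⊔ b ≤ h' := sup_le hz hb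
  have hbA : IsAtom b := hR.2.1
  have hmaps : ∀ x ∈ U h h' z, (z ⊔ b) ⊔ x ∈ U h h' (z ⊔ b) := by
    intro x hx
    obtain ⟨g1, g2, g3⟩ := mem_U.1 hx
    refine mem_U.2 ⟨sup_le (hy.trans hc.le) g1, fun hh => g2 (le_sup_right.trans hh), ?_⟩
    rw [sup_inf_assoc_of_le x hy, g3, sup_eq_left.2 le_sup_left]
  rw [Finset.card_eq_sum_card_fiberwise hmaps, mul_comm, ← smul_eq_mul]
  refine Finset.card_nsmul_le_sum _ _ _ ?_
  intro x hx
  obtain ⟨g1, g2, g3⟩ := mem_U.1 hx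
  obtain ⟨a, ha, hax, hah⟩ := exists_off g2
  have hRab : R a b := R_trans (R_off hc ha ha₀ (hax.trans g1) h1 hah h2) hR
  have hab : a ≠ b := by rintro rfl; exact hah hb
  obtain ⟨p, hp, hp1, hp2, hp3⟩ := hRab.2.2.resolve_left hab
  have hbx : b ≤ x := (le_sup_right.trans g3.ge).trans inf_le_left
  have hpx : p ≤ x := hp1.trans (sup_le hax hbx)
  have ebp : b ⊔ p = b ⊔ a := line hbA ha hp (by rwa [sup_comm]) hp3
  have hph : ¬ p ≤ h' := fun hh => hah (by
    have : b ⊔ a ≤ h' := ebp ▸ sup_le hb hh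
    exact le_sup_right.trans this)
  have eap : a ⊔ p = a ⊔ b := line ha hbA hp hp1 hp2
  have hne : z ⊔ a ≠ z ⊔ p := by
    intro hh
    have k1 : a ⊔ b ≤ z ⊔ a := eap ▸ sup_le le_sup_right (hh ▸ le_sup_right)
    have k2 : b ≤ (z ⊔ a) ⊓ h' := le_inf (le_sup_right.trans k1) hb
    rw [sup_inf_assoc_of_le a hz, atom_inf ha hah, sup_bot_eq] at k2
    exact hbz k2
  have hsub : ({z ⊔ a, z ⊔ p} : Finset L) ⊆ (U h h' z).filter (fun w => (z ⊔ b) ⊔ w = x) := by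
    intro w hw
    rw [Finset.mem_insert, Finset.mem_singleton] at hw
    rw [Finset.mem_filter]
    rcases hw with rfl | rfl
    · refine ⟨mem_U_sup hc hz ha (hax.trans g1) hah, ?_⟩
      rw [← sup_assoc, sup_eq_left.2 (le_sup_left : z ≤ z ⊔ b)]
      exact U_eq hc hx ha hax hah
    · refine ⟨mem_U_sup hc hz hp (hpx.trans g1) hph, ?_⟩
      rw [← sup_assoc, sup_eq_left.2 (le_sup_left : z ≤ z ⊔ b)]
      exact U_eq hc hx hp hpx hph
  calc 2 = ({z ⊔ a, z ⊔ p} : Finset L).card := (Finset.card_pair hne).symm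
    _ ≤ _ := Finset.card_le_card hsub

lemma U_card_Q [ComplementedLattice L] {h h' a₀ : L} (hc : h' ⋖ h)
    (ha₀ : IsAtom a₀) (h1 : a₀ ≤ h) (h2 : ¬ a₀ ≤ h') {z : L} {n : ℕ} (hQ : Q (cl a₀) z n)
    (hz : z ≤ h') : 2 ^ n * (U h h' z).card ≤ (U h h' ⊥).card := by
  induction hQ with
  | bot => simp
  | @step z n b hQ hb hbz ih =>
    have hz1 := le_sup_left.trans hz
    have := U_card_step hc hz1 (le_sup_right.trans hz) hbz ha₀ h1 h2 hb
    calc 2 ^ (n + 1) * (U h h' (z ⊔ b)).card = 2 ^ n * (2 * (U h h' (z ⊔ b)).card) := by ring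
      _ ≤ 2 ^ n * (U h h' z).card := Nat.mul_le_mul_left _ this
      _ ≤ _ := ih hz1

lemma U_card_rk [ComplementedLattice L] {h h' a₀ : L} (hc : h' ⋖ h)
    (ha₀ : IsAtom a₀) (h1 : a₀ ≤ h) (h2 : ¬ a₀ ≤ h') {y : L}
    (hy : y ≤ h') : 2 ^ (rk (cl a₀) y) * (U h h' y).card ≤ (U h h' ⊥).card := by
  obtain ⟨z, hz, hQ⟩ := rk_mem (cl a₀) y
  exact (Nat.mul_le_mul_left _ (U_card_mono hc hz hy)).trans
    (U_card_Q hc ha₀ h1 h2 hQ (hz.trans hy))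

lemma exists_coatom [ComplementedLattice L] {h a : L} (ha : IsAtom a) (hah : a ≤ h) :
    ∃ h', h' ⋖ h ∧ ¬ a ≤ h' := by
  obtain ⟨c, hc⟩ := exists_isCompl a
  have h1 : a ⊔ (c ⊓ h) = h := by
    rw [← sup_inf_assoc_of_le c hah, hc.sup_eq_top, top_inf_eq]
  have h2 : ¬ a ≤ c ⊓ h := fun hh => ha.1 (le_bot_iff.1
    (hc.inf_eq_bot ▸ le_inf le_rfl (hh.trans inf_le_left)))
  refine ⟨c ⊓ h, ?_, h2⟩
  have := atom_covBy ha h2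
  rwa [sup_comm, h1] at this

end count

section mobius
variable {L : Type*} [Lattice L] [BoundedOrder L] [Fintype L]

noncomputable def I (x y : L) : Finset L := Finset.univ.filter (fun z => x ≤ z ∧ z ≤ y)

lemma mem_I {x y z : L} : z ∈ I x y ↔ x ≤ z ∧ z ≤ y := by simp [I]

lemma mu_left {μ : L → L → ℝ} (hμ : IsMobiusFn μ) {x y : L} (h : x < y) :
    ∑ z ∈ I x y, μ x z = 0 := by
  have hI : ((I x y : Finset L) : Set L) = Set.Icc x y := by
    ext z; simp [I]
  rw [← hμ.2 x y h, ← finsum_mem_coe_finset, hI]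

lemma mu_right {μ : L → L → ℝ} (hμ : IsMobiusFn μ) {x y : L} (h : x < y) :
    ∑ z ∈ I x y, μ z y = 0 := by
  let M : Matrix L L ℝ := fun x y => if x ≤ y then μ x y else 0
  let Zm : Matrix L L ℝ := fun x y => if x ≤ y then 1 else 0
  have key : M * Zm = 1 := by
    ext x y
    rw [Matrix.mul_apply]
    have : ∑ z, M x z * Zm z y = ∑ z ∈ I x y, μ x z := by
      rw [I, Finset.sum_filter]
      refine Finset.sum_congr rfl fun z _ => ?_
      by_cases h1 : x ≤ z <;> by_cases h2 : z ≤ y <;> simp [M, Zm, h1, h2]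
    rw [this]
    by_cases hxy : x = y
    · subst hxy
      have : I x x = {x} := by
        ext z; rw [mem_I, Finset.mem_singleton]
        exact ⟨fun h => le_antisymm h.2 h.1, fun h => h ▸ ⟨le_rfl, le_rfl⟩⟩
      rw [this, Finset.sum_singleton, hμ.1, Matrix.one_apply_eq]
    · rw [Matrix.one_apply_ne hxy]
      by_cases hle : x ≤ y
      · exact mu_left hμ (lt_of_le_of_ne hle hxy)
      · have : I x y = ∅ := by
          ext z; rw [mem_I]
          simp only [Finset.notMem_empty, iff_false]
          exact fun h => hle (h.1.trans h.2)
        rw [this, Finset.sum_empty]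
  have key2 : Zm * M = 1 := mul_eq_one_comm.1 key
  have := congrFun (congrFun key2 x) y
  rw [Matrix.mul_apply, Matrix.one_apply_ne h.ne] at this
  rw [← this, I, Finset.sum_filter]
  refine Finset.sum_congr rfl fun z _ => ?_
  by_cases h1 : x ≤ z <;> by_cases h2 : z ≤ y <;> simp [M, Zm, h1, h2]

variable [IsModularLattice L]

lemma mu_transpose {μ : L → L → ℝ} (hμ : IsMobiusFn μ) (x h' : L) :
    ∀ z : L, x ⊓ h' ≤ z → z ≤ h' → μ (x ⊓ h') z = μ x (z ⊔ x) := by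
  intro z
  induction z using WellFoundedLT.induction with
  | ind z ih =>
  intro h1 h2
  rcases eq_or_lt_of_le h1 with e1 | hlt
  · rw [← e1, hμ.1, sup_eq_right.2 inf_le_left, hμ.1]
  have hzinf : ∀ w, x ⊓ h' ≤ w → w ≤ h' → (w ⊔ x) ⊓ h' = w := by
    intro w w1 w2
    rw [sup_inf_assoc_of_le x w2, sup_eq_left.2 w1]
  have hx : x < z ⊔ x := by
    refine lt_of_le_of_ne le_sup_right fun hh => ?_
    have := hzinf z h1 h2
    rw [← hh] at this
    exact hlt.ne this
  have s1 := mu_left hμ hlt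
  have s2 := mu_left hμ hx
  have s3 : ∑ w ∈ I x (z ⊔ x), μ x w = ∑ w ∈ I (x ⊓ h') z, μ x (w ⊔ x) := by
    symm
    refine Finset.sum_bij' (fun w _ => w ⊔ x) (fun w _ => w ⊓ h') ?_ ?_ ?_ ?_ ?_
    · intro w hw
      rw [mem_I] at hw ⊢
      exact ⟨le_sup_right, sup_le_sup_right hw.2 _⟩
    · intro w hw
      rw [mem_I] at hw ⊢
      refine ⟨inf_le_inf_right _ hw.1, ?_⟩
      rw [← hzinf z h1 h2]
      exact inf_le_inf_right _ hw.2
    · intro w hw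
      rw [mem_I] at hw
      exact hzinf w hw.1 (hw.2.trans h2)
    · intro w hw
      rw [mem_I] at hw
      have := sup_inf_assoc_of_le h' hw.1
      show w ⊓ h' ⊔ x = w
      rw [inf_comm, sup_comm, ← this]
      exact inf_eq_right.2 (hw.2.trans (sup_le (h2.trans le_sup_right) le_sup_left))
    · intro w hw; rfl
  rw [s3] at s2
  have hz : z ∈ I (x ⊓ h') z := mem_I.2 ⟨h1, le_rfl⟩
  rw [← Finset.add_sum_erase _ _ hz] at s1 s2
  have : ∑ w ∈ (I (x ⊓ h') z).erase z, μ (x ⊓ h') w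
      = ∑ w ∈ (I (x ⊓ h') z).erase z, μ x (w ⊔ x) := by
    refine Finset.sum_congr rfl fun w hw => ?_
    rw [Finset.mem_erase, mem_I] at hw
    exact ih w (lt_of_le_of_ne hw.2.2 hw.1) hw.2.1 (hw.2.2.trans h2)
  linarith

lemma mu_U {μ : L → L → ℝ} (hμ : IsMobiusFn μ) {h h' x y : L} (hc : h' ⋖ h)
    (hx : x ∈ U h h' y) : μ x h = μ y h' := by
  obtain ⟨h1, h2, h3⟩ := mem_U.1 hx
  have := mu_transpose hμ x h' h' inf_le_right le_rfl
  rw [h3, sup_cov hc h1 h2] at this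
  exact this.symm

lemma weisner {μ : L → L → ℝ} (hμ : IsMobiusFn μ) {h h' : L} (hlt : h' < h) :
    ∀ x : L, x ≤ h' → ∑ z ∈ Finset.univ.filter (fun z => z ≤ h ∧ z ⊓ h' = x), μ z h = 0 := by
  intro x
  induction x using WellFoundedGT.induction with
  | ind x ih =>
  intro hx
  have s1 := mu_right hμ (lt_of_le_of_lt hx hlt)
  have hmaps : ∀ z ∈ I x h, z ⊓ h' ∈ I x h' := by
    intro z hz
    rw [mem_I] at hz ⊢
    exact ⟨le_inf hz.1 hx, inf_le_right⟩
  rw [← Finset.sum_fiberwise_of_maps_to hmaps] at s1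
  have s2 : ∀ w ∈ I x h', ∑ z ∈ (I x h).filter (fun z => z ⊓ h' = w), μ z h
      = ∑ z ∈ Finset.univ.filter (fun z => z ≤ h ∧ z ⊓ h' = w), μ z h := by
    intro w hw
    rw [mem_I] at hw
    refine Finset.sum_congr ?_ fun _ _ => rfl
    ext z
    simp only [Finset.mem_filter, mem_I, Finset.mem_univ, true_and]
    constructor
    · rintro ⟨⟨-, a⟩, b⟩; exact ⟨a, b⟩
    · rintro ⟨a, b⟩; exact ⟨⟨hw.1.trans (b ▸ inf_le_left), a⟩, b⟩
  rw [Finset.sum_congr rfl s2, Finset.sum_eq_single_of_mem x (mem_I.2 ⟨le_rfl, hx⟩)] at s1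
  · exact s1
  · intro w hw hne
    rw [mem_I] at hw
    exact ih w (lt_of_le_of_ne hw.1 hne.symm) hw.2

lemma mu_cov {μ : L → L → ℝ} (hμ : IsMobiusFn μ) {h h' x : L} (hc : h' ⋖ h) (hx : x ≤ h') :
    |μ x h| = (U h h' x).card * |μ x h'| := by
  have s := weisner hμ hc.lt x hx
  have e1 : Finset.univ.filter (fun z => z ≤ h ∧ z ⊓ h' = x) = insert x (U h h' x) := by
    ext z
    simp only [Finset.mem_filter, Finset.mem_univ, true_and, Finset.mem_insert, mem_U]
    constructor
    · rintro ⟨a, b⟩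
      by_cases hz : z ≤ h'
      · left; rw [← b, inf_eq_left.2 hz]
      · exact Or.inr ⟨a, hz, b⟩
    · rintro (rfl | ⟨a, -, b⟩)
      · exact ⟨hx.trans hc.le, inf_eq_left.2 hx⟩
      · exact ⟨a, b⟩
  rw [e1, Finset.sum_insert (fun hh => (mem_U.1 hh).2.1 hx),
    Finset.sum_congr rfl (fun z hz => mu_U hμ hc hz), Finset.sum_const, nsmul_eq_mul] at s
  rw [eq_neg_of_add_eq_zero_left s, abs_neg, abs_mul, Nat.abs_cast]

end mobius

section main
variable {L : Type*} [Lattice L] [BoundedOrder L] [Fintype L] [IsModularLattice L]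
  [ComplementedLattice L]

/-- weighted sum -/
noncomputable def G (μ : L → L → ℝ) (C : Set L) (j : ℕ) (h : L) : ℝ :=
  ∑ y ∈ Finset.univ.filter (fun y => y ≤ h), ((1 / 2 : ℝ) ^ j) ^ (rk C y) * |μ y h|

lemma G_step {μ : L → L → ℝ} (hμ : IsMobiusFn μ) {h h' a₀ : L} (hc : h' ⋖ h)
    (ha₀ : IsAtom a₀) (h1 : a₀ ≤ h) (h2 : ¬ a₀ ≤ h') (j : ℕ) :
    G μ (cl a₀) j h ≤ (1 + (1 / 2 : ℝ) ^ j) * ((U h h' ⊥).card * G μ (cl a₀) (j + 1) h') := by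
  set C := cl a₀ with hC
  set t : ℝ := (1 / 2 : ℝ) ^ j with ht
  have ht0 : 0 ≤ t := by positivity
  have ht1 : t ≤ 1 := pow_le_one₀ (by norm_num) (by norm_num)
  have split : G μ C j h = ∑ y ∈ Finset.univ.filter (fun y => y ≤ h'), t ^ (rk C y) * |μ y h|
      + ∑ x ∈ Finset.univ.filter (fun x => x ≤ h ∧ ¬ x ≤ h'), t ^ (rk C x) * |μ x h| := by
    rw [G, ← Finset.sum_filter_add_sum_filter_not _ (fun y => y ≤ h')]
    congr 1
    · refine Finset.sum_congr ?_ fun _ _ => rfl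
      ext z
      simp only [Finset.mem_filter, Finset.mem_univ, true_and]
      exact ⟨fun k => k.2, fun k => ⟨k.trans hc.le, k⟩⟩
    · rw [Finset.filter_filter]
  have fib : ∑ x ∈ Finset.univ.filter (fun x => x ≤ h ∧ ¬ x ≤ h'), t ^ (rk C x) * |μ x h|
      = ∑ y ∈ Finset.univ.filter (fun y => y ≤ h'), ∑ x ∈ U h h' y, t ^ (rk C x) * |μ x h| := by
    rw [← Finset.sum_fiberwise_of_maps_to (g := fun x => x ⊓ h')
      (t := Finset.univ.filter (fun y => y ≤ h'))]
    · refine Finset.sum_congr rfl fun y _ => Finset.sum_congr ?_ fun _ _ => rfl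
      rw [Finset.filter_filter, U]
      simp only [and_assoc]
    · intro x _; simp
  rw [split, fib, ← Finset.sum_add_distrib, G, Finset.mul_sum, Finset.mul_sum]
  refine Finset.sum_le_sum fun y hy => ?_
  have hy : y ≤ h' := by simpa using hy
  have b2 : ∑ x ∈ U h h' y, t ^ (rk C x) * |μ x h|
      ≤ (U h h' y).card * (t ^ (rk C y) * t * |μ y h'|) := by
    rw [← nsmul_eq_mul]
    refine Finset.sum_le_card_nsmul _ _ _ fun x hx => ?_
    rw [mu_U hμ hc hx]
    refine mul_le_mul_of_nonneg_right ?_ (abs_nonneg _)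
    obtain ⟨g1, g2, g3⟩ := mem_U.1 hx
    obtain ⟨a, ha, hax, hah⟩ := exists_off g2
    rw [← pow_succ]
    refine pow_le_pow_of_le_one ht0 ht1 (rk_succ (a := a) ?_ (fun k => hah (k.trans hy))
      (g3 ▸ inf_le_left) hax)
    exact R_off hc ha₀ ha h1 (hax.trans g1) h2 hah
  rw [mu_cov hμ hc hy]
  have cnt : (2 : ℝ) ^ (rk C y) * (U h h' y).card ≤ (U h h' ⊥).card := by
    exact_mod_cast U_card_rk hc ha₀ h1 h2 hy
  have cnt' : ((U h h' y).card : ℝ) ≤ (1 / 2 : ℝ) ^ (rk C y) * (U h h' ⊥).card := by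
    have := mul_le_mul_of_nonneg_left cnt (by positivity : (0 : ℝ) ≤ (1 / 2 : ℝ) ^ (rk C y))
    rw [← mul_assoc, ← mul_pow] at this
    norm_num at this ⊢
    exact this
  have hw : ((1 / 2 : ℝ) ^ (j + 1)) ^ rk C y = t ^ rk C y * (1 / 2 : ℝ) ^ (rk C y) := by
    rw [pow_succ, mul_pow]
  rw [hw]
  calc _ ≤ t ^ (rk C y) * ((U h h' y).card * |μ y h'|)
        + (U h h' y).card * (t ^ (rk C y) * t * |μ y h'|) := by gcongr
    _ = ((1 + t) * (t ^ (rk C y) * |μ y h'|)) * (U h h' y).card := by ring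
    _ ≤ ((1 + t) * (t ^ (rk C y) * |μ y h'|)) * ((1 / 2 : ℝ) ^ (rk C y) * (U h h' ⊥).card) := by
        gcongr
    _ = _ := by ring

noncomputable def K (j : ℕ) : ℝ := Real.exp (2 * (1 / 2 : ℝ) ^ j)

lemma K_step (j : ℕ) : (1 + (1 / 2 : ℝ) ^ j) * K (j + 1) ≤ K j := by
  have : K j = Real.exp ((1 / 2 : ℝ) ^ j) * K (j + 1) := by
    rw [K, K, ← Real.exp_add]; congr 1; ring
  rw [this]
  refine mul_le_mul_of_nonneg_right ?_ (Real.exp_pos _).le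
  linarith [Real.add_one_le_exp ((1 / 2 : ℝ) ^ j)]

lemma K_one (j : ℕ) : 1 ≤ K j := Real.one_le_exp (by positivity)

lemma K_zero : K 0 ≤ 8 := by
  have h := Real.exp_one_lt_d9
  have h0 := Real.exp_pos 1
  have : K 0 = Real.exp 1 * Real.exp 1 := by rw [K, ← Real.exp_add]; norm_num
  rw [this]; nlinarith

lemma rk_zero {h y : L} {C : Set L} (hC : ∀ b ∈ C, ¬ b ≤ h) (hy : y ≤ h) : rk C y = 0 := by
  obtain ⟨z, hz, hQ⟩ := rk_mem C y
  rcases Q_C hQ with h0 | ⟨b, hb, hbz⟩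
  · exact h0
  · exact absurd (hbz.trans (hz.trans hy)) (hC b hb)

lemma G_zero (μ : L → L → ℝ) (C : Set L) (h : L) :
    G μ C 0 h = ∑ y ∈ Finset.univ.filter (fun y => y ≤ h), |μ y h| := by
  simp [G]

/-- unweighted bound from the weighted bounds on the same element -/
lemma total_of {μ : L → L → ℝ} (hμ : IsMobiusFn μ) {h : L}
    (H : ∀ a, IsAtom a → a ≤ h → ∀ j,
      G μ (cl a) j h ≤ |μ ⊥ h| * (K j * 8 ^ ((D h).erase (cl a)).card)) :
    ∑ y ∈ Finset.univ.filter (fun y => y ≤ h), |μ y h| ≤ |μ ⊥ h| * 8 ^ (D h).card := by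
  by_cases hb : h = ⊥
  · subst hb
    have : Finset.univ.filter (fun y : L => y ≤ ⊥) = {⊥} := by ext; simp
    rw [this, Finset.sum_singleton]
    exact le_mul_of_one_le_right (abs_nonneg _) (one_le_pow₀ (by norm_num))
  · obtain ⟨a, ha, hah⟩ := exists_atom hb
    have := H a ha hah 0
    rw [G_zero] at this
    refine this.trans (mul_le_mul_of_nonneg_left ?_ (abs_nonneg _))
    have hm : cl a ∈ D h := mem_D.2 ⟨a, ha, hah, rfl⟩
    rw [← Finset.card_erase_add_one hm, pow_succ, mul_comm]
    exact mul_le_mul_of_nonneg_left K_zero (by positivity)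

lemma weighted {μ : L → L → ℝ} (hμ : IsMobiusFn μ) (h : L) :
    ∀ a, IsAtom a → a ≤ h → ∀ j,
      G μ (cl a) j h ≤ |μ ⊥ h| * (K j * 8 ^ ((D h).erase (cl a)).card) := by
  induction h using WellFoundedLT.induction with
  | ind h ih =>
  intro a ha hah j
  obtain ⟨h', hc, hah'⟩ := exists_coatom ha hah
  have key : G μ (cl a) (j + 1) h'
      ≤ |μ ⊥ h'| * (K (j + 1) * 8 ^ ((D h').erase (cl a)).card) := by
    by_cases hm : cl a ∈ D h'
    · obtain ⟨b, hb, hbh, hcl⟩ := mem_D.1 hm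
      rw [← hcl]
      exact ih h' hc.lt b hb hbh (j + 1)
    · have hC : ∀ b ∈ cl a, ¬ b ≤ h' := fun b hb hbh =>
        hm (mem_D.2 ⟨b, hb.2.1, hbh, (cl_eq hb).symm⟩)
      have e1 : G μ (cl a) (j + 1) h'
          = ∑ y ∈ Finset.univ.filter (fun y => y ≤ h'), |μ y h'| := by
        refine Finset.sum_congr rfl fun y hy => ?_
        rw [rk_zero hC (by simpa using hy), pow_zero, one_mul]
      rw [e1, Finset.erase_eq_of_notMem hm]
      refine (total_of hμ (ih h' hc.lt)).trans (mul_le_mul_of_nonneg_left ?_ (abs_nonneg _))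
      exact le_mul_of_one_le_left (by positivity) (K_one _)
  have hcard : ((D h').erase (cl a)).card ≤ ((D h).erase (cl a)).card :=
    Finset.card_le_card (Finset.erase_subset_erase _ (D_mono hc.le))
  have hK := K_step j
  have hK1 := K_one (j + 1)
  calc G μ (cl a) j h ≤ (1 + (1 / 2 : ℝ) ^ j) * ((U h h' ⊥).card * G μ (cl a) (j + 1) h') :=
        G_step hμ hc ha hah hah' j
    _ ≤ (1 + (1 / 2 : ℝ) ^ j) * ((U h h' ⊥).card *
        (|μ ⊥ h'| * (K (j + 1) * 8 ^ ((D h').erase (cl a)).card))) := by gcongr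
    _ = |μ ⊥ h| * (((1 + (1 / 2 : ℝ) ^ j) * K (j + 1)) * 8 ^ ((D h').erase (cl a)).card) := by
        rw [mu_cov hμ hc bot_le]; ring
    _ ≤ |μ ⊥ h| * (K j * 8 ^ ((D h).erase (cl a)).card) := by
        have : (0 : ℝ) ≤ K j := zero_le_one.trans (K_one j)
        have h8 : (1 : ℝ) ≤ 8 := by norm_num
        gcongr

end main
end S13

theorem statement13 {L : Type*} [Lattice L] [BoundedOrder L] [Fintype L]
    [IsModularLattice L] [ComplementedLattice L]
    (μ : L → L → ℝ) (hμ : IsMobiusFn μ) :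
    (∑ x : L, |μ x ⊤|) ≤ |μ ⊥ ⊤| *
      (Nat.card {h : L // ∀ k₁ k₂ : L, h ⊔ (k₁ ⊓ k₂) = (h ⊔ k₁) ⊓ (h ⊔ k₂)} : ℝ) ^ 3 := by
  classical
  have h1 := S13.total_of hμ (S13.weighted hμ (⊤ : L))
  have e1 : ∑ y ∈ Finset.univ.filter (fun y : L => y ≤ ⊤), |μ y ⊤| = ∑ x : L, |μ x ⊤| := by
    refine Finset.sum_congr ?_ fun _ _ => rfl
    ext; simp
  have h2 : (2 : ℝ) ^ (S13.D (⊤ : L)).card ≤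
    (Nat.card {h : L // ∀ k₁ k₂ : L, h ⊔ (k₁ ⊓ k₂) = (h ⊔ k₁) ⊓ (h ⊔ k₂)} : ℝ) := by
    exact_mod_cast S13.card_Z (L := L)
  rw [← e1]
  refine le_trans ?_ (h1.trans (mul_le_mul_of_nonneg_left ?_ (abs_nonneg _)))
  · refine le_of_eq (Finset.sum_congr ?_ fun _ _ => rfl)
    ext; simp
  · calc (8 : ℝ) ^ (S13.D (⊤ : L)).card = ((2 : ℝ) ^ (S13.D (⊤ : L)).card) ^ 3 := by
          rw [← pow_mul, mul_comm, pow_mul]; norm_num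
      _ ≤ _ := pow_le_pow_left₀ (by positivity) h2 3
end

section
/- Let C be a diamond category and W a narrow formation. For all F ∈ W and n ∈ ℕ let p^n_{W,F} ≥ 0 be real numbers such that for all G ∈ W, sup_{n∈ℕ} ∑_{F∈W} S_{F,G} p^n_{W,F} < ∞. Then for all H ∈ W, ∑_{d∈ℕ} sup_{n∈ℕ} ( ∑_{F∈W} ∑_{ρ∈Epi(F,H), dim ss(ρ) = d} p^n_{W,F} ) < ∞, where ss(ρ) denotes the semisimplification of ρ. -/
open CategoryTheory Opposite Filter Topology MeasureTheory
open scoped ENNReal Classical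

universe u

namespace MomentCat

variable {C : Type u} [SmallCategory C]

/-- The poset of isomorphism classes of quotient objects of `G`,
realized as subobjects of `op G` in `Cᵒᵖ`.  The order is: `a ≤ b` iff `a` is a
further quotient of `b`, so that `⊤` is the class of the identity `G → G`. -/
abbrev Quotients (G : C) := Subobject (op G)

/-- The join of two quotient classes (the least upper bound, when it exists). -/
noncomputable def qSup {G : C} (a b : Quotients G) : Quotients G :=
  if h : ∃ c, IsLUB {a, b} c then h.choose else a

/-- The meet of two quotient classes (the greatest lower bound, when it exists). -/
noncomputable def qInf {G : C} (a b : Quotients G) : Quotients G :=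
  if h : ∃ c, IsGLB {a, b} c then h.choose else a

/-- The join of a set of quotient classes (when it exists). -/
noncomputable def qsSup {G : C} (s : Set (Quotients G)) : Quotients G :=
  if h : ∃ c, IsLUB s c then h.choose else ⊤

/-- The quotient class determined by an epimorphism `π : G ⟶ F`. -/
noncomputable def quotOf {G F : C} (π : G ⟶ F) (h : Epi π) : Quotients G :=
  haveI := h
  Subobject.mk π.op

/-- The underlying object of a quotient class. -/
noncomputable def qObj {G : C} (a : Quotients G) : C :=
  unop (Subobject.underlying.obj a)

/-- An object is minimal if its only quotient is itself. -/
def IsMinimalObj (G : C) : Prop := Subsingleton (Quotients G)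

/-- An epimorphism is simple if it is not an isomorphism and the interval
`[F, G]` contains only the two endpoints. -/
def IsSimpleEpi {G F : C} (π : G ⟶ F) : Prop :=
  ∃ h : Epi π, ¬IsIso π ∧ ∀ X : Quotients G, quotOf π h ≤ X → X = quotOf π h ∨ X = ⊤

/-- The interval `[a, ⊤]` is a complemented lattice. -/
def IntervalComplTop {G : C} (a : Quotients G) : Prop :=
  ∀ X : Quotients G, a ≤ X → ∃ Y : Quotients G, a ≤ Y ∧ qSup X Y = ⊤ ∧ qInf X Y = a

/-- The interval `[a, b]` is a complemented lattice. -/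
def IntervalCompl {G : C} (a b : Quotients G) : Prop :=
  ∀ X : Quotients G, a ≤ X → X ≤ b →
    ∃ Y : Quotients G, a ≤ Y ∧ Y ≤ b ∧ qSup X Y = b ∧ qInf X Y = a

/-- An epimorphism `π : G ⟶ F` is semisimple if the interval `[F,G]` is complemented. -/
def IsSemisimpleEpi {G F : C} (π : G ⟶ F) : Prop :=
  ∃ h : Epi π, IntervalComplTop (quotOf π h)

/-- A set of objects (stable under isomorphism) closed under quotients. -/
def DownwardClosed (S : Set C) : Prop :=
  ∀ G ∈ S, ∀ (F : C) (π : G ⟶ F), Epi π → F ∈ S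

/-- A set of objects closed under joins of quotients of a common object. -/
def JoinClosed (S : Set C) : Prop :=
  ∀ (G : C) (a b : Quotients G), qObj a ∈ S → qObj b ∈ S →
    (∃ c, IsLUB {a, b} c) → qObj (qSup a b) ∈ S

/-- A set of objects containing all minimal objects. -/
def MinClosed (S : Set C) : Prop := ∀ G : C, IsMinimalObj G → G ∈ S

/-- A formation: downward-closed, join-closed, containing all minimal objects. -/
def IsFormation (S : Set C) : Prop := DownwardClosed S ∧ JoinClosed S ∧ MinClosed S

/-- The smallest downward-closed join-closed set containing `B` and all minimal objects. -/
def levelGen (B : Set C) : Set C := ⋂₀ {S : Set C | IsFormation S ∧ B ⊆ S}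

/-- A level is a formation generated by a finite set of objects. -/
def IsLevel (S : Set C) : Prop := ∃ B : Set C, B.Finite ∧ S = levelGen B

/-- The type of isomorphism classes of objects of `C`. -/
abbrev IsoCls (C : Type u) [SmallCategory C] := Quotient (CategoryTheory.isIsomorphicSetoid C)

/-- The isomorphism class of an object. -/
def cls (G : C) : IsoCls C := Quotient.mk (CategoryTheory.isIsomorphicSetoid C) G

/-- The set of epimorphisms from `G` to `F`. -/
abbrev Epis (G F : C) := {π : G ⟶ F // Epi π}

/-- There is a chain of covers of length `d` from `a` to `b` (i.e. the morphism
`qObj b → qObj a` has dimension `d`). -/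
def CovChain {G : C} (a b : Quotients G) (d : ℕ) : Prop :=
  ∃ c : Fin (d + 1) → Quotients G, c 0 = a ∧ c (Fin.last d) = b ∧
    ∀ i : Fin d, c i.castSucc ⋖ c i.succ

/-- An epimorphism has dimension `d`. -/
def EpiDim {G F : C} (π : G ⟶ F) (h : Epi π) (d : ℕ) : Prop :=
  CovChain (quotOf π h) ⊤ d

/-- A set of isomorphism classes is narrow if each of its members receives simple
epimorphisms from only finitely many of its members (up to isomorphism). -/
def Narrow (S : Set C) : Prop :=
  ∀ G ∈ S, {X : IsoCls C | X.out ∈ S ∧ ∃ π : X.out ⟶ G, IsSimpleEpi π}.Finite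

/-- The minimal quotient: the bottom of the quotient poset, when it exists. -/
noncomputable def qBot (G : C) : Quotients G :=
  if h : ∃ b : Quotients G, ∀ x, b ≤ x then h.choose else ⊤

/-- `G` has complexity at most `k`: the map to the minimal quotient is a
composition of `k` semisimple epimorphisms. -/
def complexityLE (G : C) (k : ℕ) : Prop :=
  ∃ c : Fin (k + 1) → Quotients G, c 0 = qBot G ∧ c (Fin.last k) = ⊤ ∧
    ∀ i : Fin k, c i.castSucc ≤ c i.succ ∧ IntervalCompl (c i.castSucc) (c i.succ)

/-- A diamond category. -/
structure IsDiamond (C : Type u) [SmallCategory C] : Prop where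
  /-- quotient posets are finite … -/
  quotFinite : ∀ G : C, Finite (Quotients G)
  /-- … and are lattices: all pairwise joins exist … -/
  lub : ∀ (G : C) (a b : Quotients G), ∃ c, IsLUB {a, b} c
  /-- … and all pairwise meets exist … -/
  glb : ∀ (G : C) (a b : Quotients G), ∃ c, IsGLB {a, b} c
  /-- … and are modular. -/
  modular : ∀ (G : C) (a b x : Quotients G), a ≤ b →
    qSup a (qInf x b) = qInf (qSup a x) b
  /-- automorphism groups are finite -/
  autFinite : ∀ G : C, Finite (Aut G)
  /-- levels are narrow -/
  levelNarrow : ∀ S : Set C, IsLevel S → Narrow S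
  /-- countably many isomorphism classes of minimal objects -/
  minCountable : Set.Countable {X : IsoCls C | IsMinimalObj X.out}

/-- A family assigning to each object the Möbius function of its quotient poset:
`mob G x x = 1` and for `x < y`, `∑_{x ≤ z ≤ y} mob G x z = 0`. -/
def IsMobiusFamily (mob : ∀ G : C, Quotients G → Quotients G → ℝ) : Prop :=
  ∀ G : C, (∀ x : Quotients G, mob G x x = 1) ∧
    ∀ x y : Quotients G, x < y → ∑ᶠ z ∈ Set.Icc x y, mob G x z = 0

/-- `μ(π) = μ(F, G)` for an epimorphism `π : G ⟶ F`. -/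
noncomputable def muEpi (mob : ∀ G : C, Quotients G → Quotients G → ℝ)
    {G F : C} (π : G ⟶ F) (h : Epi π) : ℝ :=
  mob G (quotOf π h) ⊤

/-- `μ̂(F,G) = ∑_{π ∈ Epi(G,F)/Aut(F)} μ(π) = (∑_{π ∈ Epi(G,F)} μ(π))/|Aut F|`
(the `Aut F`-action on epimorphisms being free). -/
noncomputable def muHat (mob : ∀ G : C, Quotients G → Quotients G → ℝ) (F G : C) : ℝ :=
  (∑' π : Epis G F, muEpi mob π.1 π.2) / (Nat.card (Aut F) : ℝ)

/-- `S_{G,F} = |Epi(G,F)|/|Aut F|`. -/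
noncomputable def SQ (G F : C) : ℝ :=
  (Nat.card (Epis G F) : ℝ) / (Nat.card (Aut F) : ℝ)

/-- `T_{G,F} = μ̂(F,G)`. -/
noncomputable def TQ (mob : ∀ G : C, Quotients G → Quotients G → ℝ) (G F : C) : ℝ :=
  muHat mob F G

/-- `Z(π)`: the number of `H ∈ [F,G]` satisfying the distributive law. -/
noncomputable def Zfn {G F : C} (π : G ⟶ F) (h : Epi π) : ℕ :=
  Nat.card {H : Quotients G // quotOf π h ≤ H ∧ ∀ K₁ K₂ : Quotients G,
    quotOf π h ≤ K₁ → quotOf π h ≤ K₂ →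
      qSup H (qInf K₁ K₂) = qInf (qSup H K₁) (qSup H K₂)}

/-- The isomorphism classes lying in `W`. -/
abbrev WSub (W : Set C) := {X : IsoCls C // X.out ∈ W}

/-- `(M_G)` is well-behaved at `W`:
`∑_{G ∈ W} ∑_{π ∈ Epi(G,F)} (|μ(F,G)|/|Aut G|) Z(π)³ |M_G| < ∞` for every `F ∈ W`. -/
def WellBehavedAt (mob : ∀ G : C, Quotients G → Quotients G → ℝ) (M : IsoCls C → ℝ)
    (W : Set C) : Prop :=
  ∀ F : C, F ∈ W → Summable (fun q : Σ X : WSub W, Epis X.1.out F =>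
    |mob q.1.1.out (quotOf q.2.1 q.2.2) ⊤| / (Nat.card (Aut q.1.1.out) : ℝ)
      * ((Zfn q.2.1 q.2.2 : ℝ)) ^ 3 * |M q.1.1|)

/-- The `W`-quotient `G^W`: the join of all quotients of `G` lying in `W`. -/
noncomputable def wQuot (W : Set C) (G : C) : Quotients G :=
  qsSup {a : Quotients G | qObj a ∈ W}

/-- An epimorphism `φ : G ⟶ E` is relative-`W` if `G → G^W ∨ E` is an isomorphism. -/
def RelativeW (W : Set C) {G E : C} (φ : G ⟶ E) (h : Epi φ) : Prop :=
  qSup (wQuot W G) (quotOf φ h) = ⊤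

/-- `v_{W,F} = ∑_{G ∈ W} μ̂(F,G) M_G / |Aut G|`. -/
noncomputable def vWF (mob : ∀ G : C, Quotients G → Quotients G → ℝ) (M : IsoCls C → ℝ)
    (W : Set C) (F : C) : ℝ :=
  ∑' X : WSub W, muHat mob F X.1.out * M X.1 / (Nat.card (Aut X.1.out) : ℝ)

theorem epiComp {G F E : C} {π : G ⟶ F} {ρ : F ⟶ E} (h1 : Epi π) (h2 : Epi ρ) :
    Epi (π ≫ ρ) := by
  haveI := h1; haveI := h2; infer_instance

/-- The radical of an epimorphism with class `a`: the join of all minimal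
elements of `[a, ⊤]` distinct from `a` (together with `a` itself). -/
noncomputable def radicalEl {G : C} (a : Quotients G) : Quotients G :=
  qsSup (insert a {X : Quotients G | a ⋖ X})

end MomentCat

namespace MomentCat

section LatticePart

variable {L : Type*} [Lattice L] [IsModularLattice L]

theorem aux_sup_cov {a x y : L} (hx : a ≤ x) (hy : a ⋖ y) : x ⊔ y = x ∨ x ⋖ x ⊔ y := by
  by_cases h : y ≤ x
  · exact Or.inl (sup_eq_left.2 h)
  · right
    apply covBy_sup_of_inf_covBy_right
    have h1 : x ⊓ y = a := by
      rcases hy.eq_or_eq (le_inf hx hy.le) inf_le_right with h2 | h2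
      · exact h2
      · exact absurd (inf_eq_right.1 h2) h
    rw [h1]; exact hy

theorem aux_series (a : L) (s : Finset L) (hs : ∀ y ∈ s, a ⋖ y) :
    ∃ c : CompositionSeries L, c.head = a ∧ IsLUB (insert a (s : Set L)) c.last ∧
      c.length ≤ s.card := by
  classical
  induction s using Finset.induction_on with
  | empty => exact ⟨RelSeries.singleton _ a, by simp, by simp, by simp⟩
  | insert y s hy ih =>
    obtain ⟨c, h1, h2, h3⟩ := ih (fun z hz => hs z (Finset.mem_insert_of_mem hz))
    have hay := hs y (Finset.mem_insert_self _ _)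
    have hlub : IsLUB (insert a ((insert y s : Finset L) : Set L)) (c.last ⊔ y) := by
      rw [Finset.coe_insert, Set.insert_comm, sup_comm]
      exact h2.insert y
    rw [Finset.card_insert_of_notMem hy]
    rcases aux_sup_cov (h2.1 (Set.mem_insert _ _)) hay with h | h
    · exact ⟨c, h1, h ▸ hlub, by omega⟩
    · exact ⟨c.snoc _ h, by simpa using h1, by simpa using hlub, by simpa using h3⟩

theorem aux_count [Finite L] {a r : L} (hr : IsLUB (insert a {x | a ⋖ x}) r) {d : ℕ}
    (c : Fin (d + 1) → L) (h0 : c 0 = a) (hl : c (Fin.last d) = r)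
    (hc : ∀ i : Fin d, c i.castSucc ⋖ c i.succ) :
    d ≤ Nat.card {x // a ⋖ x} ∧ ∀ x, a ⋖ x → d ≤ Nat.card {y // x ⋖ y} + 1 := by
  classical
  have := Fintype.ofFinite L
  let c' : CompositionSeries L := ⟨d, c, hc⟩
  have hh : c'.head = a := h0
  have hl' : c'.last = r := hl
  constructor
  · obtain ⟨e, h1, h2, h3⟩ := aux_series a (Finset.univ.filter (a ⋖ ·)) (by simp)
    have h4 : e.last = r := by
      refine h2.unique ?_
      simpa using hr
    have := (CompositionSeries.jordan_holder c' e (by rw [hh, h1]) (by rw [hl', h4])).length_eq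
    rw [Nat.card_eq_fintype_card, Fintype.card_subtype]
    exact this.le.trans h3
  · intro x hx
    obtain ⟨e, h1, h2, h3⟩ := aux_series x (Finset.univ.filter (fun z => x ⋖ z ∧ z ≤ r))
      (by simp +contextual)
    have hxr : x ≤ r := hr.1 (Set.mem_insert_of_mem _ hx)
    have h4 : e.last = r := by
      refine h2.unique ⟨?_, ?_⟩
      · rintro z (rfl | hz)
        · exact hxr
        · simp at hz; exact hz.2
      · intro u hu
        have hxu : x ≤ u := hu (Set.mem_insert _ _)
        refine hr.2 ?_
        rintro z (rfl | hz)
        · exact hx.le.trans hxu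
        · rcases aux_sup_cov hx.le hz with h | h
          · exact (sup_eq_left.1 h).trans hxu
          · refine le_sup_right.trans (hu (a := x ⊔ z) (Set.mem_insert_of_mem _ ?_))
            simp only [Finset.coe_filter, Finset.mem_univ, true_and, Set.mem_setOf_eq]
            exact ⟨h, sup_le hxr (hr.1 (Set.mem_insert_of_mem _ hz))⟩
    have hx' : a ⋖ e.head := by rw [h1]; exact hx
    have := (CompositionSeries.jordan_holder c' (e.cons a hx') (by rw [hh]; simp)
      (by rw [hl', ← h4]; simp)).length_eq
    have h5 : d = e.length + 1 := by
      have h6 : c'.length = d := rfl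
      rw [h6] at this
      simpa using this
    rw [Nat.card_eq_fintype_card, Fintype.card_subtype, h5]
    have : (Finset.univ.filter (fun z => x ⋖ z ∧ z ≤ r)).card ≤
        (Finset.univ.filter (fun z => x ⋖ z)).card := by
      apply Finset.card_le_card
      intro z; simp +contextual
    omega

end LatticePart

variable {C : Type u} [SmallCategory C]

theorem aux_qSup (hC : IsDiamond C) {G : C} (a b : Quotients G) : IsLUB {a, b} (qSup a b) := by
  have h := hC.lub G a b
  unfold qSup; rw [dif_pos h]; exact h.choose_spec

theorem aux_qInf (hC : IsDiamond C) {G : C} (a b : Quotients G) : IsGLB {a, b} (qInf a b) := by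
  have h := hC.glb G a b
  unfold qInf; rw [dif_pos h]; exact h.choose_spec

/-- The lattice structure on quotients in a diamond category. -/
noncomputable abbrev quotLattice (hC : IsDiamond C) (G : C) : Lattice (Quotients G) :=
  { (inferInstance : PartialOrder (Quotients G)) with
    sup := qSup
    inf := qInf
    le_sup_left := fun a b => (aux_qSup hC a b).1 (by simp)
    le_sup_right := fun a b => (aux_qSup hC a b).1 (by simp)
    sup_le := fun a b c h1 h2 => (aux_qSup hC a b).2 (by rintro x (rfl | rfl) <;> assumption)
    inf_le_left := fun a b => (aux_qInf hC a b).1 (by simp)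
    inf_le_right := fun a b => (aux_qInf hC a b).1 (by simp)
    le_inf := fun a b c h1 h2 => (aux_qInf hC b c).2 (by rintro x (rfl | rfl) <;> assumption) }

theorem aux_quot_count (hC : IsDiamond C) {G : C} (a : Quotients G) {d : ℕ}
    (h : CovChain a (radicalEl a) d) :
    d ≤ Nat.card {x // a ⋖ x} ∧ ∀ x, a ⋖ x → d ≤ Nat.card {y // x ⋖ y} + 1 := by
  classical
  letI := quotLattice hC G
  haveI : IsModularLattice (Quotients G) := ⟨fun {x} y {z} hxz => (hC.modular G x z y hxz).ge⟩
  haveI := hC.quotFinite G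
  have := Fintype.ofFinite (Quotients G)
  obtain ⟨c, h0, hl, hc⟩ := h
  refine aux_count (r := radicalEl a) ?_ c h0 hl hc
  have hex : ∃ r, IsLUB (insert a {x : Quotients G | a ⋖ x}) r := by
    obtain ⟨e, -, h2, -⟩ := aux_series a (Finset.univ.filter (a ⋖ ·)) (by simp)
    exact ⟨e.last, by simpa using h2⟩
  unfold radicalEl qsSup
  rw [dif_pos hex]
  exact hex.choose_spec

theorem aux_quotOf_le {G F E : C} (σ : G ⟶ F) (h : Epi σ) (ρ : G ⟶ E) (h' : Epi ρ)
    (hle : quotOf ρ h' ≤ quotOf σ h) : ∃ τ : F ⟶ E, σ ≫ τ = ρ := by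
  haveI := h; haveI := h'
  refine ⟨(Subobject.ofMkLEMk _ _ hle).unop, ?_⟩
  apply Quiver.Hom.op_inj
  exact Subobject.ofMkLEMk_comp hle

/-- Epimorphisms between two objects form a finite set. -/
theorem aux_epis_finite (hC : IsDiamond C) (G F : C) : Finite (Epis G F) := by
  haveI := hC.quotFinite G
  haveI : Finite (F ≅ F) := hC.autFinite F
  refine Set.finite_univ_iff.1 (Set.Finite.preimage' (s := Set.univ)
    (f := fun π : Epis G F => quotOf π.1 π.2) Set.finite_univ fun q _ => ?_)
  by_cases hne : ∃ π0 : Epis G F, quotOf π0.1 π0.2 = q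
  swap
  · convert Set.finite_empty
    ext π; simp only [Set.mem_preimage, Set.mem_singleton_iff, Set.mem_empty_iff_false, iff_false]
    exact fun h => hne ⟨π, h⟩
  obtain ⟨π0, rfl⟩ := hne
  refine (Set.finite_range (fun e : F ≅ F =>
    (⟨π0.1 ≫ e.hom, epiComp π0.2 inferInstance⟩ : Epis G F))).subset ?_
  intro π hπ
  have hπ : quotOf π.1 π.2 = quotOf π0.1 π0.2 := hπ
  obtain ⟨f, hf⟩ := aux_quotOf_le _ π0.2 _ π.2 hπ.le
  obtain ⟨g, hg⟩ := aux_quotOf_le _ π.2 _ π0.2 hπ.ge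
  haveI := π0.2
  haveI := π.2
  refine ⟨⟨f, g, ?_, ?_⟩, ?_⟩
  · rw [← cancel_epi π0.1, reassoc_of% hf, hg, Category.comp_id]
  · rw [← cancel_epi π.1, reassoc_of% hg, hf, Category.comp_id]
  · exact Subtype.ext hf

theorem aux_factor {F H : C} (ρ : F ⟶ H) (hρ : Epi ρ) (x : Quotients F) (hx : quotOf ρ hρ ⋖ x) :
    ∃ (X : IsoCls C) (σ : Epis F X.out) (τ : Epis X.out H), σ.1 ≫ τ.1 = ρ ∧
      quotOf σ.1 σ.2 = x ∧ IsSimpleEpi τ.1 := by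
  obtain ⟨e⟩ : IsIsomorphic (Quotient.out (cls (qObj x))) (qObj x) :=
    Quotient.exact (s := isIsomorphicSetoid C) (Quotient.out_eq (cls (qObj x)))
  let X : C := Quotient.out (cls (qObj x))
  let α : F ⟶ qObj x := x.arrow.unop
  haveI : Epi α := unop_epi_of_mono x.arrow
  let σ : F ⟶ X := α ≫ e.inv
  have hσ : Epi σ := epi_comp _ _
  have hσx : quotOf σ hσ = x := by
    unfold quotOf
    conv_rhs => rw [← Subobject.mk_arrow x]
    exact Subobject.mk_eq_mk_of_comm _ _ e.symm.op rfl
  obtain ⟨τ, hτ⟩ := aux_quotOf_le σ hσ ρ hρ (by rw [hσx]; exact hx.le)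
  have hτe : Epi τ := by
    haveI := hρ
    haveI : Epi (σ ≫ τ) := by rw [hτ]; exact hρ
    exact epi_of_epi σ τ
  have hmap : ∀ h : Epi τ, (Subobject.map σ.op).obj (quotOf τ h) = quotOf ρ hρ := by
    intro h
    subst hτ
    rfl
  have htop : (Subobject.map σ.op).obj ⊤ = x := by
    rw [Subobject.map_top]; exact hσx
  refine ⟨cls (qObj x), ⟨σ, hσ⟩, ⟨τ, hτe⟩, hτ, hσx, hτe, ?_, ?_⟩
  · intro hi
    have : quotOf τ hτe = ⊤ := Subobject.mk_eq_top_of_isIso τ.op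
    rw [← hmap hτe, this, htop] at hx
    exact hx.lt.false
  · intro Z hZ
    have h1 : quotOf ρ hρ ≤ (Subobject.map σ.op).obj Z := by
      rw [← hmap hτe]; exact ((Subobject.map σ.op).map hZ.hom).le
    have h2 : (Subobject.map σ.op).obj Z ≤ x := by
      conv_rhs => rw [← htop]
      exact ((Subobject.map σ.op).map (le_top : Z ≤ ⊤).hom).le
    rcases hx.eq_or_eq h1 h2 with h | h
    · left
      apply Subobject.map_obj_injective σ.op
      rw [h]; exact (hmap hτe).symm
    · right
      apply Subobject.map_obj_injective σ.op
      rw [h]; exact htop.symm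

/-- The classes in `W` with a simple epimorphism to `H`. -/
abbrev Above (W : Set C) (H : C) := {X : IsoCls C // X.out ∈ W ∧ ∃ π : X.out ⟶ H, IsSimpleEpi π}

theorem aux_step (W : Set C) (hW : IsFormation W) {F H : C} (hF : F ∈ W)
    (g : Quotients F → ℝ≥0∞) :
    ∑' ρ : Epis F H, ∑' x : {x // quotOf ρ.1 ρ.2 ⋖ x}, g x.1 ≤
      ∑' X : Above W H, ∑' _τ : Epis X.1.out H, ∑' σ : Epis F X.1.out, g (quotOf σ.1 σ.2) := by
  have key : ∀ q : (Σ ρ : Epis F H, {x // quotOf ρ.1 ρ.2 ⋖ x}),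
      ∃ t : (Σ X : Above W H, Epis X.1.out H × Epis F X.1.out),
        t.2.2.1 ≫ t.2.1.1 = q.1.1 ∧ quotOf t.2.2.1 t.2.2.2 = q.2.1 := by
    rintro ⟨⟨ρ, hρ⟩, x, hx⟩
    obtain ⟨X, σ, τ, h1, h2, h3⟩ := aux_factor ρ hρ x hx
    exact ⟨⟨⟨X, hW.1 F hF _ σ.1 σ.2, τ.1, h3⟩, τ, σ⟩, h1, h2⟩
  choose f hf1 hf2 using key
  have hinj : Function.Injective f := by
    rintro ⟨⟨ρ, hρ⟩, x, hx⟩ ⟨⟨ρ', hρ'⟩, x', hx'⟩ he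
    have e1 : ρ = ρ' := by
      have h1 := hf1 ⟨⟨ρ, hρ⟩, x, hx⟩
      rw [he, hf1] at h1; exact h1.symm
    have e2 : x = x' := by
      have h1 := hf2 ⟨⟨ρ, hρ⟩, x, hx⟩
      rw [he, hf2] at h1; exact h1.symm
    subst e1 e2
    rfl
  have h1 := ENNReal.tsum_comp_le_tsum_of_injective hinj
    (fun t : (Σ X : Above W H, Epis X.1.out H × Epis F X.1.out) => g (quotOf t.2.2.1 t.2.2.2))
  simp only [hf2] at h1
  rw [ENNReal.tsum_sigma', ENNReal.tsum_sigma'] at h1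
  refine h1.trans (le_of_eq ?_)
  refine tsum_congr fun X => ?_
  rw [ENNReal.tsum_prod']

/-- The weighted sum of epimorphisms. -/
noncomputable def wsum {W : Set C} (p : WSub W → ℝ≥0∞) (G : C) : ℝ≥0∞ :=
  ∑' F : WSub W, ∑' _σ : Epis F.1.out G, p F

/-- The weighted sum of two-step covers above `H`. -/
noncomputable def wsum2 {W : Set C} (p : C → ℝ≥0∞) (H : C) : ℝ≥0∞ :=
  ∑' X : Above W H, ∑' _τ : Epis X.1.out H,
    ∑' Y : Above W X.1.out, ∑' _τ : Epis Y.1.out X.1.out, p Y.1.out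

theorem aux_two (hC : IsDiamond C) (W : Set C) (hW : IsFormation W)
    (p : WSub W → ℝ≥0∞) (H : C) (d : ℕ) :
    ((d : ℝ≥0∞) * ((d - 1 : ℕ) : ℝ≥0∞)) * (∑' F : WSub W,
        ∑' _ρ : {ρ : Epis F.1.out H //
            CovChain (quotOf ρ.1 ρ.2) (radicalEl (quotOf ρ.1 ρ.2)) d}, p F)
      ≤ wsum2 (W := W) (wsum p) H := by
  have hpt : ∀ F : WSub W, ((d : ℝ≥0∞) * ((d - 1 : ℕ) : ℝ≥0∞)) *
        (∑' _ρ : {ρ : Epis F.1.out H //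
            CovChain (quotOf ρ.1 ρ.2) (radicalEl (quotOf ρ.1 ρ.2)) d}, p F) ≤
      ∑' X : Above W H, ∑' _τ : Epis X.1.out H,
        ∑' Y : Above W X.1.out, ∑' _τ : Epis Y.1.out X.1.out, ∑' _σ : Epis F.1.out Y.1.out, p F := by
    intro F
    haveI := hC.quotFinite F.1.out
    calc _ = ∑' ρ : {ρ : Epis F.1.out H //
            CovChain (quotOf ρ.1 ρ.2) (radicalEl (quotOf ρ.1 ρ.2)) d},
              ((d : ℝ≥0∞) * ((d - 1 : ℕ) : ℝ≥0∞)) * p F := by rw [ENNReal.tsum_mul_left]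
      _ ≤ ∑' ρ : {ρ : Epis F.1.out H //
            CovChain (quotOf ρ.1 ρ.2) (radicalEl (quotOf ρ.1 ρ.2)) d},
            ∑' x : {x // quotOf ρ.1.1 ρ.1.2 ⋖ x}, ∑' y : {y // x.1 ⋖ y}, p F := by
          refine ENNReal.tsum_le_tsum fun ρ => ?_
          obtain ⟨h1, h2⟩ := aux_quot_count hC _ ρ.2
          calc _ = (d : ℝ≥0∞) * (((d - 1 : ℕ) : ℝ≥0∞) * p F) := by rw [mul_assoc]
            _ ≤ (Nat.card {x // quotOf ρ.1.1 ρ.1.2 ⋖ x} : ℝ≥0∞) *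
                  (((d - 1 : ℕ) : ℝ≥0∞) * p F) := by gcongr
            _ = ∑' x : {x // quotOf ρ.1.1 ρ.1.2 ⋖ x}, ((d - 1 : ℕ) : ℝ≥0∞) * p F := by
                  rw [ENNReal.tsum_const, ENat.card_eq_coe_natCard]; rfl
            _ ≤ _ := by
                  refine ENNReal.tsum_le_tsum fun x => ?_
                  rw [ENNReal.tsum_const, ENat.card_eq_coe_natCard]
                  have := h2 x.1 x.2
                  have h3 : d - 1 ≤ Nat.card {y // x.1 ⋖ y} := by omega
                  change _ ≤ ((Nat.card {y // x.1 ⋖ y} : ℕ) : ℝ≥0∞) * _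
                  gcongr
      _ ≤ ∑' ρ : Epis F.1.out H,
            ∑' x : {x // quotOf ρ.1 ρ.2 ⋖ x}, ∑' y : {y // x.1 ⋖ y}, p F :=
          ENNReal.tsum_comp_le_tsum_of_injective Subtype.val_injective
            (fun ρ : Epis F.1.out H =>
              ∑' x : {x // quotOf ρ.1 ρ.2 ⋖ x}, ∑' y : {y // x.1 ⋖ y}, p F)
      _ ≤ _ := aux_step W hW F.2 (fun x => ∑' y : {y // x ⋖ y}, p F)
      _ ≤ _ := by
          refine ENNReal.tsum_le_tsum fun X => ENNReal.tsum_le_tsum fun τ => ?_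
          exact aux_step W hW F.2 (fun _ => p F)
  rw [← ENNReal.tsum_mul_left]
  refine (ENNReal.tsum_le_tsum hpt).trans (le_of_eq ?_)
  unfold wsum2 wsum
  rw [ENNReal.tsum_comm]
  refine tsum_congr fun X => ?_
  rw [ENNReal.tsum_comm]
  refine tsum_congr fun τ => ?_
  rw [ENNReal.tsum_comm]
  refine tsum_congr fun Y => ?_
  rw [ENNReal.tsum_comm]

theorem aux_tsum_fin {ι : Type*} [Finite ι] {f : ι → ℝ≥0∞} (h : ∀ i, f i ≠ ⊤) :
    ∑' i, f i ≠ ⊤ := by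
  have := Fintype.ofFinite ι
  rw [tsum_fintype]
  exact ENNReal.sum_ne_top.2 fun i _ => h i

theorem aux_wsum2_fin (hC : IsDiamond C) (W : Set C) (hWn : Narrow W) (p : C → ℝ≥0∞)
    (hp : ∀ G ∈ W, p G ≠ ⊤) (H : C) (hH : H ∈ W) : wsum2 (W := W) p H ≠ ⊤ := by
  unfold wsum2
  haveI : Finite (Above W H) := (hWn H hH).to_subtype
  refine aux_tsum_fin fun X => ?_
  haveI := aux_epis_finite hC X.1.out H
  haveI : Finite (Above W X.1.out) := (hWn _ X.2.1).to_subtype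
  refine aux_tsum_fin fun τ => aux_tsum_fin fun Y => ?_
  haveI := aux_epis_finite hC Y.1.out X.1.out
  exact aux_tsum_fin fun _ => hp _ Y.2.1

theorem aux_wsum_le (hC : IsDiamond C) (W : Set C) (p : WSub W → ℝ) (G : C) :
    wsum (fun F => ENNReal.ofReal (p F)) G ≤
      (Nat.card (Aut G) : ℝ≥0∞) * ∑' F : WSub W, ENNReal.ofReal (SQ F.1.out G * p F) := by
  unfold wsum
  rw [← ENNReal.tsum_mul_left]
  refine ENNReal.tsum_le_tsum fun F => ?_
  haveI := aux_epis_finite hC F.1.out G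
  haveI := hC.autFinite G
  have hc : (Nat.card (Aut G) : ℝ) ≠ 0 := by
    have : 0 < Nat.card (Aut G) := Nat.card_pos
    positivity
  rw [ENNReal.tsum_const, ENat.card_eq_coe_natCard]
  change ((Nat.card (Epis F.1.out G) : ℕ) : ℝ≥0∞) * _ ≤ _
  rw [← ENNReal.ofReal_natCast, ← ENNReal.ofReal_natCast, ← ENNReal.ofReal_mul (by positivity),
    ← ENNReal.ofReal_mul (by positivity)]
  apply le_of_eq
  congr 1
  unfold SQ
  field_simp

theorem aux_sq_sum : ∑' d : ℕ, (((d : ℝ≥0∞) + 1) ^ 2)⁻¹ ≠ ⊤ := by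
  have h := (summable_nat_add_iff 1).2 (Real.summable_one_div_nat_pow.2 (by norm_num : 1 < 2))
  have h2 := h.tsum_ofReal_ne_top
  convert h2 using 3 with d
  rw [one_div, ENNReal.ofReal_inv_of_pos (by positivity), ENNReal.ofReal_pow (by positivity),
    ENNReal.ofReal_natCast]
  push_cast
  rfl

theorem aux_main (hC : IsDiamond C)
    (W : Set C) (hW : IsFormation W) (hWn : Narrow W)
    (p : ℕ → WSub W → ℝ)
    (hsup : ∀ G : C, G ∈ W →
      (⨆ n : ℕ, ∑' F : WSub W, ENNReal.ofReal (SQ F.1.out G * p n F)) ≠ ⊤) (H : C) (hH : H ∈ W) :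
      (∑' d : ℕ, ⨆ n : ℕ, ∑' F : WSub W,
        ∑' _ρ : {ρ : Epis F.1.out H //
            CovChain (quotOf ρ.1 ρ.2) (radicalEl (quotOf ρ.1 ρ.2)) d},
          ENNReal.ofReal (p n F)) ≠ ⊤ := by
  set B : C → ℝ≥0∞ := fun G => (Nat.card (Aut G) : ℝ≥0∞) *
    ⨆ n : ℕ, ∑' F : WSub W, ENNReal.ofReal (SQ F.1.out G * p n F) with hB
  have hBfin : ∀ G ∈ W, B G ≠ ⊤ := fun G hG =>
    ENNReal.mul_ne_top (ENNReal.natCast_ne_top _) (hsup G hG)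
  have hle : ∀ n G, wsum (fun F => ENNReal.ofReal (p n F)) G ≤ B G := fun n G =>
    (aux_wsum_le hC W (p n) G).trans
      (mul_le_mul_right (le_iSup (fun n => ∑' F : WSub W, ENNReal.ofReal (SQ F.1.out G * p n F)) n) _)
  set M := B H + wsum2 (W := W) B H with hM
  have hMfin : M ≠ ⊤ := ENNReal.add_ne_top.2 ⟨hBfin H hH, aux_wsum2_fin hC W hWn B hBfin H hH⟩
  have hbound : ∀ d : ℕ, (⨆ n : ℕ, ∑' F : WSub W,
        ∑' _ρ : {ρ : Epis F.1.out H //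
            CovChain (quotOf ρ.1 ρ.2) (radicalEl (quotOf ρ.1 ρ.2)) d},
          ENNReal.ofReal (p n F)) ≤ (4 * M) * (((d : ℝ≥0∞) + 1) ^ 2)⁻¹ := by
    intro d
    refine iSup_le fun n => ?_
    set A := ∑' F : WSub W,
        ∑' _ρ : {ρ : Epis F.1.out H //
            CovChain (quotOf ρ.1 ρ.2) (radicalEl (quotOf ρ.1 ρ.2)) d},
          ENNReal.ofReal (p n F) with hA
    have h1 : A ≤ B H := by
      refine le_trans ?_ (hle n H)
      unfold wsum
      refine ENNReal.tsum_le_tsum fun F => ?_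
      exact ENNReal.tsum_comp_le_tsum_of_injective Subtype.val_injective
        (fun _ : Epis F.1.out H => ENNReal.ofReal (p n F))
    have h2 : ((d : ℝ≥0∞) * ((d - 1 : ℕ) : ℝ≥0∞)) * A ≤ wsum2 (W := W) B H := by
      refine (aux_two hC W hW (fun F => ENNReal.ofReal (p n F)) H d).trans ?_
      unfold wsum2
      refine ENNReal.tsum_le_tsum fun X => ENNReal.tsum_le_tsum fun τ =>
        ENNReal.tsum_le_tsum fun Y => ENNReal.tsum_le_tsum fun τ => hle n _
    have h3 : ((d : ℝ≥0∞) + 1) ^ 2 ≤ 4 * (1 + (d : ℝ≥0∞) * ((d - 1 : ℕ) : ℝ≥0∞)) := by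
      have : (d + 1) ^ 2 ≤ 4 * (1 + d * (d - 1)) := by
        rcases d with _ | d
        · simp
        · simp only [Nat.add_sub_cancel]; nlinarith
      exact_mod_cast this
    rw [← div_eq_mul_inv, ENNReal.le_div_iff_mul_le (Or.inl (by simp))
      (Or.inl (by finiteness))]
    calc A * ((d : ℝ≥0∞) + 1) ^ 2 ≤ A * (4 * (1 + (d : ℝ≥0∞) * ((d - 1 : ℕ) : ℝ≥0∞))) := by gcongr
      _ = 4 * (A + ((d : ℝ≥0∞) * ((d - 1 : ℕ) : ℝ≥0∞)) * A) := by ring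
      _ ≤ 4 * M := by rw [hM]; gcongr
  refine ne_top_of_le_ne_top ?_ (ENNReal.tsum_le_tsum hbound)
  rw [ENNReal.tsum_mul_left]
  exact ENNReal.mul_ne_top (ENNReal.mul_ne_top (by simp) hMfin) aux_sq_sum

end MomentCat

open MomentCat in
/-- Lemma 4.15: for a narrow formation `W` and nonnegative
`p^n_{W,F}` with `sup_n ∑_{F∈W} S_{F,G} p^n_{W,F} < ∞` for all `G ∈ W`, one has
`∑_{d∈ℕ} sup_n (∑_{F∈W} ∑_{ρ∈Epi(F,H), dim ss(ρ) = d} p^n_{W,F}) < ∞`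
for all `H ∈ W`, where `ss(ρ)` is the semisimplification of `ρ`. -/
theorem statement14 {C : Type u} [SmallCategory C] (hC : IsDiamond C)
    (W : Set C) (hW : IsFormation W) (hWn : Narrow W)
    (p : ℕ → WSub W → ℝ) (hp : ∀ (n : ℕ) (F : WSub W), 0 ≤ p n F)
    (hsup : ∀ G : C, G ∈ W →
      (⨆ n : ℕ, ∑' F : WSub W, ENNReal.ofReal (SQ F.1.out G * p n F)) ≠ ⊤) :
    ∀ H : C, H ∈ W →
      (∑' d : ℕ, ⨆ n : ℕ, ∑' F : WSub W,
        ∑' _ρ : {ρ : Epis F.1.out H //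
            CovChain (quotOf ρ.1 ρ.2) (radicalEl (quotOf ρ.1 ρ.2)) d},
          ENNReal.ofReal (p n F)) ≠ ⊤ := by
  intro H hH
  exact aux_main hC W hW hWn p hsup H hH
end

section
/- Let C be a diamond category and W a narrow formation of finite complexity. For all F ∈ W and n ∈ ℕ let p^n_{W,F} ≥ 0 be real numbers. Suppose that for each F ∈ W the limit lim_{n→∞} p^n_{W,F} exists, and that for all G ∈ W, sup_n ∑_{F∈W} S_{F,G} p^n_{W,F} < ∞. Then for all G ∈ W, lim_{n→∞} ∑_{F∈W} S_{F,G} p^n_{W,F} = ∑_{F∈W} S_{F,G} · lim_{n→∞} p^n_{W,F}. -/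
open CategoryTheory Opposite Filter Topology MeasureTheory
open scoped ENNReal Classical

universe u

namespace MomentAux

section Order

variable {α : Type*} [PartialOrder α]

/-- `b` is the join of the covers of `a` lying below `b`. -/
def JoinAtoms (a b : α) : Prop :=
  a ≤ b ∧ ∀ u, a ≤ u → (∀ x, a ⋖ x → x ≤ b → x ≤ u) → b ≤ u

/-- Length at most `k` in terms of `JoinAtoms` steps up to the top. -/
def Lv [OrderTop α] : ℕ → α → Prop
  | 0, a => a = ⊤
  | k + 1, a => ∃ b, JoinAtoms a b ∧ Lv k b

/-- Chain of at most `d` covers. -/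
def Rel : ℕ → α → α → Prop
  | 0, a, c => a = c
  | d + 1, a, c => ∃ m, Rel d a m ∧ (m = c ∨ m ⋖ c)

/-- Upper semimodularity in the form needed. -/
def SemiMod (α : Type*) [PartialOrder α] : Prop :=
  ∀ a x y z : α, a ⋖ x → a ≤ y → IsLUB {x, y} z → z = y ∨ y ⋖ z

theorem rel_mono {a c : α} {d e : ℕ} (h : d ≤ e) (hr : Rel d a c) : Rel e a c := by
  induction h with
  | refl => exact hr
  | step _ ih => exact ⟨c, ih, Or.inl rfl⟩

theorem semiMod_of {α : Type*} [Lattice α] [IsModularLattice α] : SemiMod α := by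
  intro a x y z hax hay hz
  have hz' : z = x ⊔ y := hz.unique isLUB_pair
  subst hz'
  by_cases hxy : x ≤ y
  · left; exact sup_eq_right.2 hxy
  · right
    have h1 : x ⊓ y = a := by
      have h2 : a ≤ x ⊓ y := le_inf hax.le hay
      rcases hax.eq_or_eq h2 inf_le_left with h | h
      · exact h
      · exact absurd (inf_eq_left.1 h) hxy
    apply covBy_sup_of_inf_covBy_left
    rw [h1]; exact hax

theorem joinAtoms_transfer (hs : SemiMod α) (hl : ∀ a b : α, ∃ c, IsLUB {a, b} c)
    {c c' a b : α} (hJ : JoinAtoms c c') (hca : c ≤ a) (hb : IsLUB {a, c'} b) :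
    JoinAtoms a b := by
  have hab : a ≤ b := hb.1 (by simp)
  have hcb : c' ≤ b := hb.1 (by simp)
  refine ⟨hab, fun u hau hu => ?_⟩
  apply hb.2
  have key : c' ≤ u := by
    apply hJ.2 u (hca.trans hau)
    intro x hx hxc
    obtain ⟨z, hz⟩ := hl x a
    have hxz : x ≤ z := hz.1 (by simp)
    have hzb : z ≤ b := by
      apply hz.2
      intro t ht
      rcases ht with rfl | rfl
      · exact hxc.trans hcb
      · exact hab
    rcases hs c x a z hx hca hz with h | h
    · exact hxz.trans (h.le.trans hau)
    · exact hxz.trans (hu z h hzb)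
  intro t ht
  rcases ht with rfl | rfl
  · exact hau
  · exact key

theorem lv_of_chain [OrderTop α] (hs : SemiMod α) (hl : ∀ a b : α, ∃ c, IsLUB {a, b} c)
    (k : ℕ) : ∀ (a : α) (c : Fin (k + 1) → α), c 0 ≤ a → c (Fin.last k) = ⊤ →
      (∀ i : Fin k, JoinAtoms (c i.castSucc) (c i.succ)) → Lv k a := by
  induction k with
  | zero =>
    intro a c h0 h1 _
    have : c 0 = ⊤ := h1
    rw [this] at h0
    exact top_le_iff.1 h0
  | succ k ih =>
    intro a c h0 h1 h2
    obtain ⟨b, hb⟩ := hl a (c 1)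
    refine ⟨b, joinAtoms_transfer hs hl (h2 0) h0 hb, ?_⟩
    apply ih b (fun i => c i.succ)
    · exact hb.1 (by simp)
    · exact h1
    · intro i
      exact h2 i.succ

theorem rel_of_joinAtoms [Finite α] (hs : SemiMod α) (hl : ∀ a b : α, ∃ c, IsLUB {a, b} c)
    {a b : α} (hJ : JoinAtoms a b) (d : ℕ) (hd : Set.ncard {x | a ⋖ x} ≤ d) : Rel d a b := by
  have key : ∀ s : Finset α, (∀ x ∈ s, a ⋖ x ∧ x ≤ b) →
      ∃ c, a ≤ c ∧ c ≤ b ∧ (∀ x ∈ s, x ≤ c) ∧ Rel s.card a c := by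
    intro s
    induction s using Finset.induction_on with
    | empty => intro _; exact ⟨a, le_rfl, hJ.1, by simp, rfl⟩
    | insert x s hx ih =>
      intro h
      obtain ⟨c, h1, h2, h3, h4⟩ := ih (fun y hy => h y (Finset.mem_insert_of_mem hy))
      have hxb := h x (Finset.mem_insert_self x s)
      obtain ⟨z, hz⟩ := hl x c
      have hcz : c ≤ z := hz.1 (by simp)
      have hxz : x ≤ z := hz.1 (by simp)
      refine ⟨z, h1.trans hcz, ?_, ?_, ?_⟩
      · apply hz.2
        intro t ht
        rcases ht with rfl | rfl
        · exact hxb.2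
        · exact h2
      · intro y hy
        rcases Finset.mem_insert.1 hy with rfl | hy
        · exact hxz
        · exact (h3 y hy).trans hcz
      · rw [Finset.card_insert_of_notMem hx]
        refine ⟨c, h4, ?_⟩
        rcases hs a x c z hxb.1 h1 hz with h | h
        · exact Or.inl h.symm
        · exact Or.inr h
  have hfin : Set.Finite {x | a ⋖ x ∧ x ≤ b} := Set.toFinite _
  obtain ⟨c, h1, h2, h3, h4⟩ := key hfin.toFinset (by intro x hx; simpa using hx)
  have hcb : c = b := by
    apply le_antisymm h2
    apply hJ.2 c h1
    intro x hx hxb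
    exact h3 x (by simpa using ⟨hx, hxb⟩)
  subst hcb
  refine rel_mono (le_trans ?_ hd) h4
  rw [← Set.ncard_eq_toFinset_card _ hfin]
  exact Set.ncard_le_ncard (fun x hx => hx.1) (Set.toFinite _)

theorem joinAtoms_of_compl [Finite α] (hg : ∀ a b : α, ∃ c, IsGLB {a, b} c) {a b : α}
    (hab : a ≤ b)
    (h : ∀ X, a ≤ X → X ≤ b → ∃ Y, a ≤ Y ∧ Y ≤ b ∧ IsLUB {X, Y} b ∧ IsGLB {X, Y} a) :
    JoinAtoms a b := by
  refine ⟨hab, fun u hau hu => ?_⟩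
  obtain ⟨X, hX⟩ := hg u b
  have hXu : X ≤ u := hX.1 (by simp)
  have hXb : X ≤ b := hX.1 (by simp)
  have haX : a ≤ X := by
    apply hX.2
    intro t ht
    rcases ht with rfl | rfl
    · exact hau
    · exact hab
  obtain ⟨Y, h1, h2, h3, h4⟩ := h X haX hXb
  have hY : Y = a := by
    by_contra hne
    have hlt : a < Y := lt_of_le_of_ne h1 (Ne.symm hne)
    obtain ⟨x, hx, hxY⟩ := exists_covBy_le_of_lt hlt
    have hxb := hxY.trans h2
    have hxu := hu x hx hxb
    have hxX : x ≤ X := by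
      apply hX.2
      intro t ht
      rcases ht with rfl | rfl
      · exact hxu
      · exact hxb
    have : x ≤ a := by
      apply h4.2
      intro t ht
      rcases ht with rfl | rfl
      · exact hxX
      · exact hxY
    exact absurd hx.lt (not_lt_of_ge this)
  have : b ≤ X := by
    apply h3.2
    intro t ht
    rcases ht with rfl | rfl
    · exact le_rfl
    · rw [hY]; exact haX
  exact this.trans hXu

end Order

section Tight

variable {ι : Type*}

/-- Uniform smallness of tails. -/
def Tight (w : ℕ → ι → ℝ≥0∞) (f : ι → ℝ≥0∞) : Prop :=
  ∀ ε : ℝ≥0∞, ε ≠ 0 → ∃ T : Finset ι, ∀ n, ∑' i, (if i ∈ T then 0 else f i * w n i) ≤ ε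

theorem Tight.mono {w : ℕ → ι → ℝ≥0∞} {f g : ι → ℝ≥0∞} (hg : Tight w g) (h : ∀ i, f i ≤ g i) :
    Tight w f := by
  intro ε hε
  obtain ⟨T, hT⟩ := hg ε hε
  refine ⟨T, fun n => le_trans (ENNReal.tsum_le_tsum fun i => ?_) (hT n)⟩
  split_ifs
  · exact le_rfl
  · gcongr; exact h i

theorem tail_anti {T T' : Finset ι} (h : T ⊆ T') (g : ι → ℝ≥0∞) :
    ∑' i, (if i ∈ T' then 0 else g i) ≤ ∑' i, (if i ∈ T then 0 else g i) := by
  refine ENNReal.tsum_le_tsum fun i => ?_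
  by_cases h1 : i ∈ T
  · simp [h1, h h1]
  · by_cases h2 : i ∈ T' <;> simp [h1, h2]

theorem Tight.add {w : ℕ → ι → ℝ≥0∞} {f g : ι → ℝ≥0∞} (hf : Tight w f) (hg : Tight w g) :
    Tight w (fun i => f i + g i) := by
  intro ε hε
  have h2 : ε / 2 ≠ 0 := (ENNReal.half_pos hε).ne'
  obtain ⟨T, hT⟩ := hf (ε / 2) h2
  obtain ⟨T', hT'⟩ := hg (ε / 2) h2
  refine ⟨T ∪ T', fun n => ?_⟩
  calc ∑' i, (if i ∈ T ∪ T' then 0 else (f i + g i) * w n i)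
      = ∑' i, ((if i ∈ T ∪ T' then 0 else f i * w n i) +
          (if i ∈ T ∪ T' then 0 else g i * w n i)) := by
        congr 1; ext i; split_ifs
        · simp
        · rw [add_mul]
    _ = _ + _ := ENNReal.tsum_add
    _ ≤ ε / 2 + ε / 2 := by
        gcongr
        · exact (tail_anti Finset.subset_union_left _).trans (hT n)
        · exact (tail_anti Finset.subset_union_right _).trans (hT' n)
    _ = ε := ENNReal.add_halves ε

theorem Tight.zero {w : ℕ → ι → ℝ≥0∞} : Tight w (fun _ => 0) := by
  intro ε _
  exact ⟨∅, fun n => by simp⟩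

theorem Tight.sum {κ : Type*} {w : ℕ → ι → ℝ≥0∞} (s : Finset κ) (f : κ → ι → ℝ≥0∞)
    (h : ∀ j ∈ s, Tight w (f j)) : Tight w (fun i => ∑ j ∈ s, f j i) := by
  induction s using Finset.induction_on with
  | empty => simpa using Tight.zero
  | insert x s hx ih =>
    simp only [Finset.sum_insert hx]
    exact (h x (Finset.mem_insert_self x s)).add
      (ih fun j hj => h j (Finset.mem_insert_of_mem hj))

theorem Tight.mul_nat {w : ℕ → ι → ℝ≥0∞} {f : ι → ℝ≥0∞} (h : Tight w f) (m : ℕ) :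
    Tight w (fun i => f i * m) := by
  have := Tight.sum (Finset.range m) (fun _ => f) (fun _ _ => h)
  refine this.mono fun i => ?_
  simp [mul_comm]

/-- The Markov step. -/
theorem tight_of_markov {w : ℕ → ι → ℝ≥0∞} {f h : ι → ℝ≥0∞} (B : ℝ≥0∞) (hB : B ≠ ⊤)
    (hh : ∀ n, ∑' i, h i * w n i ≤ B)
    (H : ∀ d : ℕ, d ≠ 0 → ∃ g, Tight w g ∧ ∀ i, f i ≤ h i / d + g i) : Tight w f := by
  intro ε hε
  have h2 : ε / 2 ≠ 0 := (ENNReal.half_pos hε).ne'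
  obtain ⟨d, hd0, hd⟩ : ∃ d : ℕ, d ≠ 0 ∧ B / d ≤ ε / 2 := by
    obtain ⟨d, hd⟩ := ENNReal.exists_nat_gt (ENNReal.div_ne_top hB h2)
    refine ⟨d + 1, by omega, ?_⟩
    apply ENNReal.div_le_of_le_mul
    rw [mul_comm]
    have : B ≤ d * (ε / 2) := by
      by_cases ht : ε / 2 = ⊤
      · by_cases hd' : d = 0
        · subst hd'; simp at hd
        · rw [ht, ENNReal.mul_top (by exact_mod_cast hd')]; exact le_top
      · exact (ENNReal.div_le_iff_le_mul (Or.inl h2) (Or.inl ht)).1 hd.le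
    refine this.trans ?_
    gcongr
    simp
  obtain ⟨g, hg, hfg⟩ := H d hd0
  obtain ⟨T, hT⟩ := hg (ε / 2) h2
  refine ⟨T, fun n => ?_⟩
  calc ∑' i, (if i ∈ T then 0 else f i * w n i)
      ≤ ∑' i, ((h i * w n i) * (d : ℝ≥0∞)⁻¹ + (if i ∈ T then 0 else g i * w n i)) := by
        refine ENNReal.tsum_le_tsum fun i => ?_
        split_ifs
        · exact zero_le
        · calc f i * w n i ≤ (h i / d + g i) * w n i := by gcongr; exact hfg i
            _ = _ := by rw [add_mul, div_eq_mul_inv]; ring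
    _ = (∑' i, h i * w n i) * (d : ℝ≥0∞)⁻¹ + ∑' i, (if i ∈ T then 0 else g i * w n i) := by
        rw [ENNReal.tsum_add, ENNReal.tsum_mul_right]
    _ ≤ B / d + ε / 2 := by
        rw [div_eq_mul_inv]
        gcongr
        · exact hh n
        · exact hT n
    _ ≤ ε / 2 + ε / 2 := by gcongr
    _ = ε := ENNReal.add_halves ε

/-- Exchange of limit and sum under tightness. -/
theorem tendsto_of_tight (s : ι → ℝ) (hs : ∀ i, 0 ≤ s i) (p : ℕ → ι → ℝ)
    (hp : ∀ n i, 0 ≤ p n i) (pl : ι → ℝ)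
    (hlim : ∀ i, Tendsto (fun n => p n i) atTop (𝓝 (pl i)))
    (hsup : (⨆ n, ∑' i, ENNReal.ofReal (s i * p n i)) ≠ ⊤)
    (ht : Tight (fun n i => ENNReal.ofReal (p n i)) (fun i => ENNReal.ofReal (s i))) :
    Tendsto (fun n => ∑' i, s i * p n i) atTop (𝓝 (∑' i, s i * pl i)) := by
  have hpl : ∀ i, 0 ≤ pl i := fun i => ge_of_tendsto' (hlim i) fun n => hp n i
  have hsum : ∀ n, Summable fun i => s i * p n i := by
    intro n
    have h1 : (∑' i, ENNReal.ofReal (s i * p n i)) ≠ ⊤ :=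
      ne_top_of_le_ne_top hsup (le_iSup (fun n => ∑' i, ENNReal.ofReal (s i * p n i)) n)
    have := ENNReal.summable_toReal h1
    refine this.congr fun i => ?_
    exact ENNReal.toReal_ofReal (mul_nonneg (hs i) (hp n i))
  have hbd : ∀ T : Finset ι, ∀ n, ∑ i ∈ T, s i * p n i ≤
      (⨆ n, ∑' i, ENNReal.ofReal (s i * p n i)).toReal := by
    intro T n
    rw [← ENNReal.ofReal_le_iff_le_toReal hsup,
      ENNReal.ofReal_sum_of_nonneg (fun i _ => mul_nonneg (hs i) (hp n i))]
    exact (ENNReal.sum_le_tsum T).trans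
      (le_iSup (fun n => ∑' i, ENNReal.ofReal (s i * p n i)) n)
  have hfl : ∀ T : Finset ι, Tendsto (fun n => ∑ i ∈ T, s i * p n i) atTop
      (𝓝 (∑ i ∈ T, s i * pl i)) :=
    fun T => tendsto_finsetSum T fun i _ => (hlim i).const_mul (s i)
  have hsl : Summable fun i => s i * pl i :=
    summable_of_sum_le (fun i => mul_nonneg (hs i) (hpl i))
      (fun T => le_of_tendsto' (hfl T) (hbd T))
  have hunif : TendstoUniformlyOnFilter (fun (T : Finset ι) n => ∑ i ∈ T, s i * p n i)
      (fun n => ∑' i, s i * p n i) atTop atTop := by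
    apply TendstoUniformly.tendstoUniformlyOnFilter |> fun h => (h ?_).mono_right le_top
    rw [Metric.tendstoUniformly_iff]
    intro ε hε
    obtain ⟨T₀, hT₀⟩ := ht (ENNReal.ofReal (ε / 2)) (by simpa using hε)
    filter_upwards [eventually_ge_atTop T₀] with T hT n
    have hle : ∑ i ∈ T, s i * p n i ≤ ∑' i, s i * p n i :=
      (hsum n).sum_le_tsum T (fun i _ => mul_nonneg (hs i) (hp n i))
    rw [Real.dist_eq, abs_of_nonneg (by linarith)]
    suffices h : ∑' i, s i * p n i ≤ ∑ i ∈ T, s i * p n i + ε / 2 by linarith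
    apply (hsum n).tsum_le_of_sum_le
    intro U
    have hU : ∑ i ∈ U \ T, s i * p n i ≤ ε / 2 := by
      rw [← ENNReal.ofReal_le_ofReal_iff (by positivity),
        ENNReal.ofReal_sum_of_nonneg (fun i _ => mul_nonneg (hs i) (hp n i))]
      refine le_trans ?_ (hT₀ n)
      refine le_trans ?_ (ENNReal.sum_le_tsum (U \ T))
      refine Finset.sum_le_sum fun i hi => ?_
      have : i ∉ T₀ := fun h => (Finset.mem_sdiff.1 hi).2 (hT h)
      simp only [this, if_false]
      rw [ENNReal.ofReal_mul (hs i)]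
    calc ∑ i ∈ U, s i * p n i ≤ ∑ i ∈ T ∪ (U \ T), s i * p n i := by
          apply Finset.sum_le_sum_of_subset_of_nonneg
          · intro i hi; by_cases h : i ∈ T <;> simp [h, hi]
          · intro i _ _; exact mul_nonneg (hs i) (hp n i)
      _ = ∑ i ∈ T, s i * p n i + ∑ i ∈ U \ T, s i * p n i :=
          Finset.sum_union Finset.disjoint_sdiff
      _ ≤ _ := by linarith
  exact hunif.tendsto_of_eventually_tendsto (Eventually.of_forall hfl) hsl.hasSum

end Tight

end MomentAux

namespace MomentAux

open MomentCat

variable {C : Type u} [SmallCategory C]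

theorem cls_eq_iff {G H : C} : cls G = cls H ↔ Nonempty (G ≅ H) := by
  unfold cls
  rw [Quotient.eq]
  rfl

theorem cls_out (X : IsoCls C) : cls X.out = X := Quotient.out_eq X

theorem cls_quotOf {F H : C} (π : F ⟶ H) (h : Epi π) : cls (qObj (quotOf π h)) = cls H := by
  haveI := h
  rw [cls_eq_iff]
  exact ⟨(Subobject.underlyingIso π.op).symm.unop⟩

theorem iso_epi {X Y : C} (e : X ≅ Y) : Epi e.hom := inferInstance

theorem exists_quotOf {F H : C} (a : Quotients F) (h : cls (qObj a) = cls H) :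
    ∃ (π : F ⟶ H) (hπ : Epi π), quotOf π hπ = a := by
  obtain ⟨e⟩ : Nonempty (unop (Subobject.underlying.obj a) ≅ H) := cls_eq_iff.1 h
  have hepi : Epi a.arrow.unop := inferInstance
  have hE : Epi (a.arrow.unop ≫ e.hom) := epiComp hepi (iso_epi e)
  refine ⟨a.arrow.unop ≫ e.hom, hE, ?_⟩
  unfold quotOf
  symm
  refine Subobject.eq_mk_of_comm _ e.symm.op ?_
  change e.inv.op ≫ (a.arrow.unop ≫ e.hom).op = a.arrow
  rw [op_comp, ← Category.assoc, ← op_comp]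
  simp

theorem simple_of_covBy {F G H : C} (g : F ⟶ G) (hg : Epi g) (h : F ⟶ H) (hh : Epi h)
    (hc : quotOf g hg ⋖ quotOf h hh) : ∃ π : H ⟶ G, IsSimpleEpi π := by
  haveI := hg
  haveI := hh
  have hle : Subobject.mk g.op ≤ Subobject.mk h.op := hc.le
  have hcomp : Subobject.ofMkLEMk _ _ hle ≫ h.op = g.op := Subobject.ofMkLEMk_comp hle
  obtain ⟨π, hπ⟩ : ∃ π : H ⟶ G, π.op = Subobject.ofMkLEMk _ _ hle := ⟨_, rfl⟩
  rw [← hπ] at hcomp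
  have hmono : Mono π.op := by rw [hπ]; infer_instance
  have hepi : Epi π := unop_epi_of_mono π.op
  have hmap : (Subobject.map h.op).obj (Subobject.mk π.op) = Subobject.mk g.op := by
    rw [Subobject.map_mk]
    congr 1
  have hmaptop : (Subobject.map h.op).obj ⊤ = Subobject.mk h.op := Subobject.map_top _
  refine ⟨π, hepi, ?_, ?_⟩
  · intro hiso
    have h1 : Subobject.mk π.op = ⊤ := Subobject.mk_eq_top_of_isIso _
    rw [h1, hmaptop] at hmap
    exact hc.lt.ne hmap.symm
  · intro X hX
    have h1 : Subobject.mk g.op ≤ (Subobject.map h.op).obj X := by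
      rw [← hmap]
      exact (Subobject.map h.op).monotone hX
    have h2 : (Subobject.map h.op).obj X ≤ Subobject.mk h.op := by
      rw [← hmaptop]
      exact (Subobject.map h.op).monotone le_top
    rcases hc.eq_or_eq h1 h2 with h3 | h3
    · left
      apply Subobject.map_obj_injective h.op
      rw [h3]
      exact hmap.symm
    · right
      apply Subobject.map_obj_injective h.op
      rw [h3, hmaptop]
      rfl

theorem card_below {F : C} (hC : IsDiamond C) (b : Quotients F) (X : IsoCls C)
    (hb : cls (qObj b) = X) :
    Nat.card {a : Quotients F // a ≤ b} ≤ Nat.card (Quotients X.out) := by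
  obtain ⟨h, hh, rfl⟩ := exists_quotOf (H := X.out) b (hb.trans (cls_out X).symm)
  haveI := hh
  haveI := hC.quotFinite X.out
  have hmaptop : (Subobject.map h.op).obj ⊤ = Subobject.mk h.op := Subobject.map_top _
  let f : Quotients X.out → {a : Quotients F // a ≤ quotOf h hh} := fun x =>
    ⟨(Subobject.map h.op).obj x, by
      have : (Subobject.map h.op).obj x ≤ (Subobject.map h.op).obj ⊤ :=
        (Subobject.map h.op).monotone le_top
      rw [hmaptop] at this
      exact this⟩
  apply Nat.card_le_card_of_surjective f
  rintro ⟨a, ha⟩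
  have ha' : a ≤ Subobject.mk h.op := ha
  refine ⟨Subobject.mk (Subobject.ofLEMk a h.op ha'), ?_⟩
  apply Subtype.ext
  change (Subobject.map h.op).obj (Subobject.mk (Subobject.ofLEMk a h.op ha')) = a
  rw [Subobject.map_mk]
  symm
  apply Subobject.eq_mk_of_comm _ (Iso.refl _)
  simp

theorem SQ_eq (hC : IsDiamond C) (F G : C) :
    SQ F G = (Nat.card {a : Quotients F // cls (qObj a) = cls G} : ℝ) := by
  haveI := hC.autFinite G
  choose r hr hrq using fun a : {a : Quotients F // cls (qObj a) = cls G} =>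
    exists_quotOf a.1 a.2
  let f : {a : Quotients F // cls (qObj a) = cls G} × Aut G → Epis F G := fun x =>
    ⟨r x.1 ≫ x.2.hom, epiComp (hr x.1) (iso_epi x.2)⟩
  have hq : ∀ x, quotOf (f x).1 (f x).2 = x.1.1 := by
    intro x
    haveI := hr x.1
    haveI := (f x).2
    rw [← hrq x.1]
    unfold quotOf
    exact Subobject.mk_eq_mk_of_comm _ _ x.2.op (by rfl)
  have hbij : Function.Bijective f := by
    constructor
    · rintro ⟨a, g⟩ ⟨a', g'⟩ hxy
      have h1 : a = a' := by
        apply Subtype.ext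
        have h2 := hq (a, g)
        have h3 := hq (a', g')
        simp only [hxy] at h2
        exact h2.symm.trans h3
      subst h1
      haveI := hr a
      have h4 : r a ≫ g.hom = r a ≫ g'.hom := congrArg Subtype.val hxy
      rw [cancel_epi] at h4
      have : g = g' := Iso.ext h4
      rw [this]
    · rintro ⟨π, hπ⟩
      let a : {a : Quotients F // cls (qObj a) = cls G} := ⟨quotOf π hπ, cls_quotOf π hπ⟩
      haveI := hr a
      haveI := hπ
      have h1 : Subobject.mk π.op = Subobject.mk (r a).op := (hrq a).symm
      refine ⟨(a, (Subobject.isoOfMkEqMk _ _ h1).unop), ?_⟩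
      apply Subtype.ext
      change r a ≫ (Subobject.isoOfMkEqMk _ _ h1).hom.unop = π
      apply Quiver.Hom.op_inj
      rw [op_comp]
      simp
  have hcard := Nat.card_congr (Equiv.ofBijective f hbij)
  rw [Nat.card_prod] at hcard
  have hpos : (Nat.card (Aut G) : ℝ) ≠ 0 := by
    have : 0 < Nat.card (Aut G) := Nat.card_pos
    positivity
  unfold SQ
  rw [← hcard]
  push_cast
  field_simp

/-! Lattice structure -/

theorem qSup_isLUB (hC : IsDiamond C) {F : C} (a b : Quotients F) : IsLUB {a, b} (qSup a b) := by
  unfold qSup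
  rw [dif_pos (hC.lub F a b)]
  exact (hC.lub F a b).choose_spec

theorem qInf_isGLB (hC : IsDiamond C) {F : C} (a b : Quotients F) : IsGLB {a, b} (qInf a b) := by
  unfold qInf
  rw [dif_pos (hC.glb F a b)]
  exact (hC.glb F a b).choose_spec

/-- The lattice of quotients. -/
@[reducible] noncomputable def quotLattice (hC : IsDiamond C) (F : C) : Lattice (Quotients F) :=
  { (inferInstance : PartialOrder (Quotients F)) with
    sup := qSup
    inf := qInf
    le_sup_left := fun a b => (qSup_isLUB hC a b).1 (by simp)
    le_sup_right := fun a b => (qSup_isLUB hC a b).1 (by simp)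
    sup_le := fun a b c h1 h2 => (qSup_isLUB hC a b).2 (by
      intro t ht
      rcases ht with rfl | rfl
      · exact h1
      · exact h2)
    inf_le_left := fun a b => (qInf_isGLB hC a b).1 (by simp)
    inf_le_right := fun a b => (qInf_isGLB hC a b).1 (by simp)
    le_inf := fun a b c h1 h2 => (qInf_isGLB hC b c).2 (by
      intro t ht
      rcases ht with rfl | rfl
      · exact h1
      · exact h2) }

theorem quot_semiMod (hC : IsDiamond C) (F : C) : SemiMod (Quotients F) := by
  letI L := quotLattice hC F
  haveI : @IsModularLattice (Quotients F) L := by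
    refine @IsModularLattice.mk _ L ?_
    intro x y z hxz
    exact (hC.modular F x z y hxz).ge
  exact @semiMod_of (Quotients F) L this

theorem qBot_le (hC : IsDiamond C) (F : C) (x : Quotients F) : qBot F ≤ x := by
  have h : ∃ b : Quotients F, ∀ x, b ≤ x := by
    haveI := hC.quotFinite F
    obtain ⟨m, _, hm⟩ := (Set.toFinite (Set.univ : Set (Quotients F))).exists_le_minimal
      (Set.mem_univ ⊤)
    refine ⟨m, fun x => ?_⟩
    have h1 : qInf m x ≤ m := (qInf_isGLB hC m x).1 (by simp)
    exact (hm.2 trivial h1).trans ((qInf_isGLB hC m x).1 (by simp))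
  unfold qBot
  rw [dif_pos h]
  exact h.choose_spec x

theorem lv_of_complexity (hC : IsDiamond C) {F : C} {k : ℕ} (hk : complexityLE F k)
    (a : Quotients F) : Lv k a := by
  haveI := hC.quotFinite F
  obtain ⟨c, h0, h1, h2⟩ := hk
  refine lv_of_chain (quot_semiMod hC F) (hC.lub F) k a c (h0 ▸ qBot_le hC F a) h1 ?_
  intro i
  apply joinAtoms_of_compl (hC.glb F) (h2 i).1
  intro X hX hX'
  obtain ⟨Y, hY, hY', h3, h4⟩ := (h2 i).2 X hX hX'
  exact ⟨Y, hY, hY', h3 ▸ qSup_isLUB hC X Y, h4 ▸ qInf_isGLB hC X Y⟩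

/-- Classes reachable from `X` by at most `d` simple epimorphisms inside `W`. -/
def reachSet (W : Set C) (X : IsoCls C) : ℕ → Set (IsoCls C)
  | 0 => {X}
  | d + 1 => reachSet W X d ∪
      ⋃ H ∈ reachSet W X d, {Y | Y.out ∈ W ∧ ∃ π : Y.out ⟶ H.out, IsSimpleEpi π}

theorem reachSet_mem (W : Set C) (X : IsoCls C) (hX : X.out ∈ W) (d : ℕ) :
    ∀ Y ∈ reachSet W X d, Y.out ∈ W := by
  induction d with
  | zero => intro Y hY; rw [Set.mem_singleton_iff.1 hY]; exact hX
  | succ d ih =>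
    intro Y hY
    rcases hY with hY | hY
    · exact ih Y hY
    · simp only [Set.mem_iUnion] at hY
      obtain ⟨H, _, hY⟩ := hY
      exact hY.1

theorem reachSet_finite (W : Set C) (hWn : Narrow W) (X : IsoCls C) (hX : X.out ∈ W) (d : ℕ) :
    (reachSet W X d).Finite := by
  induction d with
  | zero => exact Set.finite_singleton X
  | succ d ih =>
    exact ih.union (ih.biUnion fun H hH => hWn H.out (reachSet_mem W X hX d H hH))

theorem mem_of_quot {W : Set C} (hW : IsFormation W) {F : C} (hF : F ∈ W) (a : Quotients F) :
    (cls (qObj a)).out ∈ W := by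
  obtain ⟨π, hπ, _⟩ := exists_quotOf a (cls_out (cls (qObj a))).symm
  exact hW.1 F hF _ π hπ

theorem rel_reach {W : Set C} (hW : IsFormation W) {F : C} (hF : F ∈ W) (a : Quotients F)
    (d : ℕ) : ∀ b, Rel d a b → cls (qObj b) ∈ reachSet W (cls (qObj a)) d := by
  induction d with
  | zero => intro b hb; have : a = b := hb; subst this; exact Set.mem_singleton _
  | succ d ih =>
    rintro b ⟨m, hm, rfl | hmb⟩
    · exact Or.inl (ih _ hm)
    · right
      simp only [Set.mem_iUnion]
      refine ⟨_, ih m hm, mem_of_quot hW hF b, ?_⟩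
      obtain ⟨g, hg, hgm⟩ := exists_quotOf m (cls_out (cls (qObj m))).symm
      obtain ⟨h, hh, hhb⟩ := exists_quotOf b (cls_out (cls (qObj b))).symm
      apply simple_of_covBy g hg h hh
      rw [hgm, hhb]
      exact hmb

/-- Number of quotients of `F` in the class `X` satisfying `Q`. -/
noncomputable def cnt (F : C) (X : IsoCls C) (Q : Quotients F → Prop) : ℕ :=
  Nat.card {a : Quotients F // cls (qObj a) = X ∧ Q a}

theorem pairs_le (hC : IsDiamond C) (F : C) (R : Finset (IsoCls C)) (Q : Quotients F → Prop) :
    Nat.card {x : Quotients F × Quotients F // x.1 ≤ x.2 ∧ cls (qObj x.2) ∈ R ∧ Q x.2} ≤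
      ∑ H ∈ R, cnt F H Q * Nat.card (Quotients H.out) := by
  haveI := hC.quotFinite F
  letI := Fintype.ofFinite (Quotients F)
  have h1 : Nat.card {x : Quotients F × Quotients F // x.1 ≤ x.2 ∧ cls (qObj x.2) ∈ R ∧ Q x.2} =
      (Finset.univ.filter fun x : Quotients F × Quotients F =>
        x.1 ≤ x.2 ∧ cls (qObj x.2) ∈ R ∧ Q x.2).card := by
    rw [Nat.card_eq_fintype_card, Fintype.card_subtype]
  have h2 : ∀ H, cnt F H Q = (Finset.univ.filter fun b : Quotients F =>
      cls (qObj b) = H ∧ Q b).card := by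
    intro H
    unfold cnt
    rw [Nat.card_eq_fintype_card, Fintype.card_subtype]
  rw [h1, Finset.card_eq_sum_card_fiberwise (f := fun x => cls (qObj x.2)) (t := R)
    (by intro x hx; simp at hx; exact hx.2.1)]
  refine Finset.sum_le_sum fun H hH => ?_
  rw [h2 H]
  rw [Finset.card_eq_sum_card_fiberwise (f := fun x => x.2)
    (t := Finset.univ.filter fun b : Quotients F => cls (qObj b) = H ∧ Q b)
    (by intro x hx; simp at hx; simp; exact ⟨hx.2, hx.1.2.2⟩)]
  rw [← smul_eq_mul]
  refine Finset.sum_le_card_nsmul _ _ _ fun b hb => ?_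
  simp only [Finset.mem_filter, Finset.mem_univ, true_and] at hb
  refine le_trans ?_ (card_below hC b H hb.1)
  rw [Nat.card_eq_fintype_card, Fintype.card_subtype]
  apply Finset.card_le_card_of_injOn (fun x => x.1)
  · intro x hx
    simp at hx ⊢
    rw [← hx.2]; exact hx.1.1.1
  · intro x hx y hy hxy
    simp at hx hy
    exact Prod.ext hxy (hx.2.trans hy.2.symm)

theorem cnt_le (hC : IsDiamond C) {W : Set C} (hW : IsFormation W) {F : C} (hF : F ∈ W)
    (X : IsoCls C) (k d : ℕ) (R1 Rd : Finset (IsoCls C)) (h1 : ↑R1 = reachSet W X 1)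
    (hd : ↑Rd = reachSet W X d) :
    ∃ e : ℕ, cnt F X (Lv (k + 1)) ≤
        e + ∑ H ∈ Rd, cnt F H (Lv k) * Nat.card (Quotients H.out) ∧
      d * e ≤ ∑ H ∈ R1, cnt F H (fun _ => True) * Nat.card (Quotients H.out) := by
  haveI := hC.quotFinite F
  letI := Fintype.ofFinite (Quotients F)
  let big : Quotients F → Prop := fun a => d ≤ Set.ncard {x | a ⋖ x}
  refine ⟨cnt F X big, ?_, ?_⟩
  · refine le_trans ?_ (Nat.add_le_add_left (pairs_le hC F Rd (Lv k)) _)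
    have hex : ∀ a : {a : Quotients F // (cls (qObj a) = X ∧ Lv (k + 1) a) ∧ ¬ big a},
        ∃ b, a.1 ≤ b ∧ cls (qObj b) ∈ Rd ∧ Lv k b := by
      rintro ⟨a, ⟨ha, b, hJ, hb⟩, hbig⟩
      refine ⟨b, hJ.1, ?_, hb⟩
      have := rel_reach hW hF a d b
        (rel_of_joinAtoms (quot_semiMod hC F) (hC.lub F) hJ d (not_le.1 hbig).le)
      rw [ha, ← hd] at this
      exact this
    choose b hb using hex
    have hA : cnt F X (Lv (k + 1)) ≤ cnt F X big +
        Nat.card {a : Quotients F // (cls (qObj a) = X ∧ Lv (k + 1) a) ∧ ¬ big a} := by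
      unfold cnt
      simp only [Nat.card_eq_fintype_card, Fintype.card_subtype]
      rw [← Finset.card_filter_add_card_filter_not
        (s := Finset.univ.filter fun a : Quotients F => cls (qObj a) = X ∧ Lv (k + 1) a) big]
      rw [Finset.filter_filter, Finset.filter_filter]
      gcongr
      tauto
    refine hA.trans (Nat.add_le_add_left ?_ _)
    apply Nat.card_le_card_of_injective (f := fun a => ⟨(a.1, b a), hb a⟩)
    intro a a' haa
    simp only [Subtype.mk.injEq, Prod.mk.injEq] at haa
    exact Subtype.ext haa.1
  · refine le_trans ?_ (pairs_le hC F R1 (fun _ => True))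
    have hB : d * cnt F X big ≤ (Finset.univ.filter fun x : Quotients F × Quotients F =>
        (cls (qObj x.1) = X ∧ big x.1) ∧ x.1 ⋖ x.2).card := by
      unfold cnt
      rw [Nat.card_eq_fintype_card, Fintype.card_subtype]
      rw [Finset.card_eq_sum_card_fiberwise (f := fun x : Quotients F × Quotients F => x.1)
        (t := Finset.univ.filter fun a : Quotients F => cls (qObj a) = X ∧ big a)
        (by intro x hx; simp at hx; simp; exact hx.1)]
      rw [mul_comm, ← smul_eq_mul]
      refine Finset.card_nsmul_le_sum _ _ _ fun a ha => ?_
      simp only [Finset.mem_filter, Finset.mem_univ, true_and] at ha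
      refine le_trans ha.2 ?_
      rw [Set.ncard_eq_toFinset_card']
      apply Finset.card_le_card_of_injOn (fun x => (a, x))
      · intro x hx
        simp at hx ⊢
        exact ⟨ha, hx⟩
      · intro x _ y _ hxy
        exact (Prod.mk.inj hxy).2
    refine hB.trans ?_
    rw [Nat.card_eq_fintype_card, Fintype.card_subtype]
    apply Finset.card_le_card
    intro x hx
    simp only [Finset.mem_filter, Finset.mem_univ, true_and, and_true] at hx ⊢
    refine ⟨hx.2.le, ?_⟩
    have := rel_reach hW hF x.1 1 x.2 ⟨x.1, rfl, Or.inr hx.2⟩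
    rw [hx.1.1, ← h1] at this
    exact this

theorem tight_lv (hC : IsDiamond C) {W : Set C} (hW : IsFormation W) (hWn : Narrow W)
    (w : ℕ → WSub W → ℝ≥0∞)
    (hw : ∀ X : IsoCls C, X.out ∈ W →
      (⨆ n, ∑' F : WSub W, (cnt F.1.out X (fun _ => True) : ℝ≥0∞) * w n F) ≠ ⊤) (k : ℕ) :
    ∀ X : IsoCls C, X.out ∈ W → Tight w (fun F => (cnt F.1.out X (Lv k) : ℝ≥0∞)) := by
  induction k with
  | zero =>
    intro X hX ε _
    refine ⟨{⟨X, hX⟩}, fun n => ?_⟩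
    refine le_trans (le_of_eq ?_) (zero_le (a := ε))
    rw [ENNReal.tsum_eq_zero]
    intro F
    split_ifs with h
    · rfl
    · have : cnt F.1.out X (Lv 0) = 0 := by
        unfold cnt
        rw [Nat.card_eq_zero]
        left
        refine ⟨?_⟩
        rintro ⟨a, ha, ha'⟩
        apply h
        have ha'' : a = ⊤ := ha'
        subst ha''
        rw [Finset.mem_singleton]
        apply Subtype.ext
        have h3 : cls (qObj (⊤ : Quotients F.1.out)) = cls F.1.out :=
          cls_quotOf (𝟙 F.1.out) inferInstance
        exact (cls_out F.1).symm.trans (h3.symm.trans ha)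
      simp [this]
  | succ k ih =>
    intro X hX
    have hfin := reachSet_finite W hWn X hX
    let R : ℕ → Finset (IsoCls C) := fun d => (hfin d).toFinset
    have hR : ∀ d, ↑(R d) = reachSet W X d := fun d => (hfin d).coe_toFinset
    have hRW : ∀ d, ∀ H ∈ R d, H.out ∈ W := fun d H hH =>
      reachSet_mem W X hX d H ((hfin d).mem_toFinset.1 hH)
    let h : WSub W → ℝ≥0∞ := fun F =>
      ∑ H ∈ R 1, (cnt F.1.out H (fun _ => True) : ℝ≥0∞) * (Nat.card (Quotients H.out) : ℝ≥0∞)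
    refine tight_of_markov (h := h) (∑ H ∈ R 1,
      (⨆ n, ∑' F : WSub W, (cnt F.1.out H (fun _ => True) : ℝ≥0∞) * w n F) *
        (Nat.card (Quotients H.out) : ℝ≥0∞)) ?_ ?_ ?_
    · refine (ENNReal.sum_lt_top.2 fun H hH => ?_).ne
      exact ENNReal.mul_lt_top (hw H (hRW 1 H hH)).lt_top (by simp)
    · intro n
      calc ∑' F, h F * w n F
          = ∑' F, ∑ H ∈ R 1, ((cnt F.1.out H (fun _ => True) : ℝ≥0∞) * w n F) *
              (Nat.card (Quotients H.out) : ℝ≥0∞) := by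
            congr 1; ext F
            simp only [h, Finset.sum_mul]
            refine Finset.sum_congr rfl fun H _ => ?_
            ring
        _ = ∑ H ∈ R 1, ∑' F : WSub W, ((cnt F.1.out H (fun _ => True) : ℝ≥0∞) * w n F) *
              (Nat.card (Quotients H.out) : ℝ≥0∞) :=
            Summable.tsum_finsetSum fun _ _ => ENNReal.summable
        _ ≤ _ := by
            refine Finset.sum_le_sum fun H _ => ?_
            rw [ENNReal.tsum_mul_right]
            gcongr
            exact le_iSup (fun n => ∑' F : WSub W,
              (cnt F.1.out H (fun _ => True) : ℝ≥0∞) * w n F) n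
    · intro d hd
      refine ⟨fun F => ∑ H ∈ R d, (cnt F.1.out H (Lv k) : ℝ≥0∞) *
        (Nat.card (Quotients H.out) : ℝ≥0∞), ?_, ?_⟩
      · exact Tight.sum (R d) (fun H (F : WSub W) => (cnt F.1.out H (Lv k) : ℝ≥0∞) *
          (Nat.card (Quotients H.out) : ℝ≥0∞)) fun H hH => (ih H (hRW d H hH)).mul_nat _
      · intro F
        obtain ⟨e, he1, he2⟩ := cnt_le hC hW F.2 X k d (R 1) (R d) (hR 1) (hR d)
        have he1' : (cnt F.1.out X (Lv (k + 1)) : ℝ≥0∞) ≤ e + ∑ H ∈ R d,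
            (cnt F.1.out H (Lv k) : ℝ≥0∞) * (Nat.card (Quotients H.out) : ℝ≥0∞) := by
          exact_mod_cast he1
        have he2' : (d : ℝ≥0∞) * e ≤ h F := by
          simp only [h]
          exact_mod_cast he2
        refine he1'.trans ?_
        gcongr
        rw [ENNReal.le_div_iff_mul_le (Or.inl (by exact_mod_cast hd)) (Or.inl (by simp)),
          mul_comm]
        exact he2'

end MomentAux

open MomentCat in
/-- Lemma 4.18: for a narrow formation `W` of finite
complexity and nonnegative `p^n_{W,F}` with pointwise limits and uniformly
bounded moments, the limit may be exchanged with the moment sum: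
`lim_n ∑_{F∈W} S_{F,G} p^n_{W,F} = ∑_{F∈W} S_{F,G} lim_n p^n_{W,F}`. -/
theorem statement16 {C : Type u} [SmallCategory C] (hC : IsDiamond C)
    (W : Set C) (hW : IsFormation W) (hWn : Narrow W)
    (hfc : ∃ k : ℕ, ∀ G ∈ W, complexityLE G k)
    (p : ℕ → WSub W → ℝ) (hp : ∀ (n : ℕ) (F : WSub W), 0 ≤ p n F)
    (pl : WSub W → ℝ)
    (hlim : ∀ F : WSub W, Filter.Tendsto (fun n => p n F) Filter.atTop (nhds (pl F)))
    (hsup : ∀ G : C, G ∈ W →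
      (⨆ n : ℕ, ∑' F : WSub W, ENNReal.ofReal (SQ F.1.out G * p n F)) ≠ ⊤) :
    ∀ G : C, G ∈ W →
      Filter.Tendsto (fun n => ∑' F : WSub W, SQ F.1.out G * p n F) Filter.atTop
        (nhds (∑' F : WSub W, SQ F.1.out G * pl F)) := by
  intro G hG
  obtain ⟨k, hk⟩ := hfc
  have hcls : (cls G).out ∈ W := by
    obtain ⟨e⟩ := MomentAux.cls_eq_iff.1 (MomentAux.cls_out (cls G))
    exact hW.1 G hG _ e.inv inferInstance
  have hSQ : ∀ (F : C) (H : C), SQ F H = (MomentAux.cnt F (cls H) (fun _ => True) : ℝ) := by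
    intro F H
    rw [MomentAux.SQ_eq hC]
    unfold MomentAux.cnt
    simp
  have hof : ∀ (F : C) (H : C), ENNReal.ofReal (SQ F H) =
      (MomentAux.cnt F (cls H) (fun _ => True) : ℝ≥0∞) := by
    intro F H
    rw [hSQ, ENNReal.ofReal_natCast]
  have hnn : ∀ (F : C) (H : C), 0 ≤ SQ F H := fun F H => by rw [hSQ]; positivity
  refine MomentAux.tendsto_of_tight (fun F : WSub W => SQ F.1.out G) (fun F => hnn _ _) p hp pl
    hlim (hsup G hG) ?_
  have ht := MomentAux.tight_lv hC hW hWn (fun n F => ENNReal.ofReal (p n F)) (by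
    intro X hX
    have := hsup X.out hX
    simp only [ENNReal.ofReal_mul (hnn _ _), hof, MomentAux.cls_out] at this
    exact this) k (cls G) hcls
  refine ht.mono fun F => ?_
  rw [hof]
  have : (fun _ : Quotients F.1.out => True) = MomentAux.Lv k := by
    funext a
    exact (eq_true (MomentAux.lv_of_complexity hC (hk _ F.2) a)).symm
  rw [this]
end

section
/- Let ν be a finitely additive nonnegative set function on an algebra 𝒜 of subsets of a set X, with ν(X) = b finite. For each ℓ ∈ ℕ, let ℒ_ℓ be a countable collection of elements of 𝒜 whose disjoint union is X. Assume: (1) for every A ∈ 𝒜 there is some ℓ such that for all ℓ' ≥ ℓ, A is a countable disjoint union of elements of ℒ_{ℓ'}; (2) any sequence L_n ∈ ℒ_n with L_i ∩ L_j nonempty for all i,j has nonempty intersection ∩_j L_j; (3) for i ≤ j, U_i ∈ ℒ_i and U_j ∈ ℒ_j, the intersection U_i ∩ U_j is either empty or equal to U_j; (4) for each ℓ, ∑_{L ∈ ℒ_ℓ} ν(L) = b. Then ν is countably additive on 𝒜. -/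
/-- Lemma 5.1: a finitely additive nonnegative set function on
an algebra of sets, admitting countable partitions `ℒ_ℓ` with properties (1)–(4),
is countably additive on the algebra. -/
theorem statement17 {X : Type*} (𝒜 : Set (Set X))
    (huniv : Set.univ ∈ 𝒜)
    (hcompl : ∀ A ∈ 𝒜, Aᶜ ∈ 𝒜)
    (hunion : ∀ A ∈ 𝒜, ∀ B ∈ 𝒜, A ∪ B ∈ 𝒜)
    (ν : Set X → ℝ)
    (hpos : ∀ A ∈ 𝒜, 0 ≤ ν A)
    (hadd : ∀ A ∈ 𝒜, ∀ B ∈ 𝒜, Disjoint A B → ν (A ∪ B) = ν A + ν B)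
    (b : ℝ) (hb : ν Set.univ = b)
    (ℒ : ℕ → Set (Set X))
    (hcount : ∀ ℓ : ℕ, (ℒ ℓ).Countable)
    (hmem : ∀ ℓ : ℕ, ℒ ℓ ⊆ 𝒜)
    (hdisj : ∀ ℓ : ℕ, (ℒ ℓ).PairwiseDisjoint id)
    (hcover : ∀ ℓ : ℕ, ⋃₀ ℒ ℓ = Set.univ)
    (h1 : ∀ A ∈ 𝒜, ∃ ℓ : ℕ, ∀ ℓ' : ℕ, ℓ ≤ ℓ' → ∃ T : Set (Set X), T ⊆ ℒ ℓ' ∧ A = ⋃₀ T)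
    (h2 : ∀ L : ℕ → Set X, (∀ n, L n ∈ ℒ n) →
      (∀ i j : ℕ, (L i ∩ L j).Nonempty) → (⋂ j : ℕ, L j).Nonempty)
    (h3 : ∀ i j : ℕ, i ≤ j → ∀ U ∈ ℒ i, ∀ V ∈ ℒ j, U ∩ V = ∅ ∨ U ∩ V = V)
    (h4 : ∀ ℓ : ℕ, HasSum (fun L : (ℒ ℓ) => ν L) b) :
    ∀ A ∈ 𝒜, ∀ f : ℕ → Set X, (∀ n, f n ∈ 𝒜) →
      (Pairwise fun i j => Disjoint (f i) (f j)) → A = ⋃ n, f n →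
      HasSum (fun n => ν (f n)) (ν A) := by
  classical
  have hempty : (∅ : Set X) ∈ 𝒜 := by simpa using hcompl _ huniv
  have hinter : ∀ A ∈ 𝒜, ∀ B ∈ 𝒜, A ∩ B ∈ 𝒜 := by
    intro A hA B hB
    have := hcompl _ (hunion _ (hcompl _ hA) _ (hcompl _ hB))
    simpa [Set.compl_union] using this
  have hν0 : ν ∅ = 0 := by
    have := hadd ∅ hempty ∅ hempty (by simp)
    simp at this
    exact this
  have hmono : ∀ A ∈ 𝒜, ∀ B ∈ 𝒜, A ⊆ B → ν A ≤ ν B := by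
    intro A hA B hB hAB
    have hD : B ∩ Aᶜ ∈ 𝒜 := hinter _ hB _ (hcompl _ hA)
    have h := hadd A hA (B ∩ Aᶜ) hD
      (Set.disjoint_left.2 fun x hx hx' => hx'.2 hx)
    have e : A ∪ (B ∩ Aᶜ) = B := by
      ext x
      by_cases hx : x ∈ A
      · simp [hx, hAB hx]
      · simp [hx]
    rw [e] at h
    linarith [hpos _ hD]
  have hcomplν : ∀ A ∈ 𝒜, ν A + ν Aᶜ = b := by
    intro A hA
    rw [← hadd A hA Aᶜ (hcompl _ hA) disjoint_compl_right, Set.union_compl_self, hb]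
  -- finite unions
  have hfin : ∀ {ι : Type _} (g : ι → Set X) (F : Finset ι), (∀ i ∈ F, g i ∈ 𝒜) →
      (∀ i j, i ≠ j → Disjoint (g i) (g j)) →
      (⋃ i ∈ F, g i) ∈ 𝒜 ∧ ν (⋃ i ∈ F, g i) = ∑ i ∈ F, ν (g i) := by
    intro ι g F
    induction F using Finset.induction_on with
    | empty => intro _ _; simp [hempty, hν0]
    | insert a s ha ih =>
      intro hm hd
      obtain ⟨i1, i2⟩ := ih (fun i hi => hm i (Finset.mem_insert_of_mem hi)) hd
      have hma := hm a (Finset.mem_insert_self _ _)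
      rw [Finset.set_biUnion_insert, Finset.sum_insert ha, ← i2]
      refine ⟨hunion _ hma _ i1, hadd _ hma _ i1 ?_⟩
      rw [Set.disjoint_iUnion₂_right]
      intro i hi
      exact hd _ _ (fun h => ha (h ▸ hi))
  have hfinN : ∀ (g : ℕ → Set X), (∀ i, g i ∈ 𝒜) →
      (∀ i j, i ≠ j → Disjoint (g i) (g j)) → ∀ n : ℕ,
      (⋃ i ∈ Finset.range n, g i) ∈ 𝒜 ∧
        ν (⋃ i ∈ Finset.range n, g i) = ∑ i ∈ Finset.range n, ν (g i) := by
    intro g hm hd n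
    induction n with
    | zero => simp [hempty, hν0]
    | succ n ih =>
      obtain ⟨i1, i2⟩ := ih
      rw [Finset.range_add_one, Finset.set_biUnion_insert, Finset.sum_insert (by simp), ← i2]
      refine ⟨hunion _ (hm n) _ i1, hadd _ (hm n) _ i1 ?_⟩
      rw [Set.disjoint_iUnion₂_right]
      intro i hi
      exact hd _ _ (fun h => by simp [h] at hi)
  -- approximating sets
  have hK : ∀ (ℓ : ℕ) (δ : ℝ), 0 < δ → ∃ F : Finset (ℒ ℓ),
      (⋃ L ∈ F, (L : Set X)) ∈ 𝒜 ∧ ν (⋃ L ∈ F, (L : Set X))ᶜ < δ := by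
    intro ℓ δ hδ
    obtain ⟨F, hF⟩ := ((h4 ℓ).eventually (lt_mem_nhds (sub_lt_self b hδ))).exists
    obtain ⟨k1, k2⟩ := hfin (fun L : ℒ ℓ => (L : Set X)) F (fun L _ => hmem ℓ L.2)
      (fun L L' h => hdisj ℓ L.2 L'.2 (fun h' => h (Subtype.ext h')))
    refine ⟨F, k1, ?_⟩
    have := hcomplν _ k1
    linarith
  -- continuity at the empty set
  have hcont : ∀ (B : ℕ → Set X), (∀ n, B n ∈ 𝒜) → Antitone B → ∀ ε : ℝ, 0 < ε →
      (∀ n, ε ≤ ν (B n)) → (⋂ n, B n).Nonempty := by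
    intro B hB hanti ε hε hBε
    choose F hF1 hF2 using fun ℓ : ℕ => hK ℓ (ε / 2 * (1 / 2) ^ (ℓ + 1)) (by positivity)
    have hD : ∀ n k : ℕ, ∃ D ∈ 𝒜, D ⊆ B n ∧ (∀ i < k, D ⊆ ⋃ L ∈ F i, (L : Set X)) ∧
        ε / 2 + ε / 2 * (1 / 2) ^ k ≤ ν D := by
      intro n k
      induction k with
      | zero => exact ⟨B n, hB n, subset_rfl, by simp, by have := hBε n; simp; linarith⟩
      | succ k ih =>
        obtain ⟨D, d1, d2, d3, d4⟩ := ih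
        refine ⟨D ∩ ⋃ L ∈ F k, (L : Set X), hinter _ d1 _ (hF1 k),
          Set.inter_subset_left.trans d2, ?_, ?_⟩
        · intro i hi
          rcases Nat.lt_succ_iff_lt_or_eq.1 hi with h | rfl
          · exact Set.inter_subset_left.trans (d3 i h)
          · exact Set.inter_subset_right
        · have e1 := hadd _ (hinter _ d1 _ (hF1 k)) _ (hinter _ d1 _ (hcompl _ (hF1 k)))
            (Set.disjoint_left.2 fun x hx hx' => hx'.2 hx.2)
          rw [Set.inter_union_compl] at e1
          have e2 := hmono _ (hinter _ d1 _ (hcompl _ (hF1 k))) _ (hcompl _ (hF1 k))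
            Set.inter_subset_right
          have e3 := hF2 k
          have e4 : (1 / 2 : ℝ) ^ k = 2 * (1 / 2) ^ (k + 1) := by rw [pow_succ]; ring
          rw [e4] at d4
          linarith
    have hx : ∀ n : ℕ, ∃ x, x ∈ B n ∧ ∀ i < n, x ∈ ⋃ L ∈ F i, (L : Set X) := by
      intro n
      obtain ⟨D, d1, d2, d3, d4⟩ := hD n n
      have : D.Nonempty := by
        rw [Set.nonempty_iff_ne_empty]
        rintro rfl
        have : 0 < ε / 2 + ε / 2 * (1 / 2) ^ n := by positivity
        linarith
      obtain ⟨x, hx⟩ := this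
      exact ⟨x, d2 hx, fun i hi => d3 i hi hx⟩
    choose x hxB hxF using hx
    have hU : ((Filter.hyperfilter ℕ : Ultrafilter ℕ) : Filter ℕ) ≤ Filter.atTop :=
      Nat.hyperfilter_le_atTop
    have hL : ∀ ℓ : ℕ, ∃ L ∈ ℒ ℓ, ∀ᶠ n in (Filter.hyperfilter ℕ : Filter ℕ), x n ∈ L := by
      intro ℓ
      have h : ∀ᶠ n in (Filter.hyperfilter ℕ : Filter ℕ), ∃ L ∈ (F ℓ : Set (ℒ ℓ)), x n ∈ (L : Set X) := by
        refine hU ?_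
        filter_upwards [Filter.eventually_gt_atTop ℓ] with n hn
        simpa using hxF n ℓ hn
      have h' : (⋃ L ∈ (F ℓ : Set (ℒ ℓ)), {n | x n ∈ (L : Set X)}) ∈ Filter.hyperfilter ℕ := by
        refine Filter.mem_of_superset h ?_
        intro n hn
        simpa using hn
      rw [Ultrafilter.finite_biUnion_mem_iff (F ℓ).finite_toSet] at h'
      obtain ⟨L, _, hL⟩ := h'
      exact ⟨L, L.2, hL⟩
    choose L hL1 hL2 using hL
    obtain ⟨y, hy⟩ := h2 L hL1 (fun i j => by
      obtain ⟨n, hn⟩ := ((hL2 i).and (hL2 j)).exists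
      exact ⟨x n, hn⟩)
    refine ⟨y, Set.mem_iInter.2 fun m => ?_⟩
    obtain ⟨ℓ, hℓ⟩ := h1 (B m) (hB m)
    obtain ⟨T, hT, hBT⟩ := hℓ ℓ le_rfl
    obtain ⟨n, hn1, hn2⟩ := ((hL2 ℓ).and (hU (Filter.eventually_ge_atTop m))).exists
    have hxm : x n ∈ B m := hanti hn2 (hxB n)
    rw [hBT] at hxm ⊢
    obtain ⟨V, hV, hxV⟩ := hxm
    have : V = L ℓ := by
      by_contra hne
      exact Set.disjoint_left.1 (hdisj ℓ (hT hV) (hL1 ℓ) hne) hxV hn1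
    exact ⟨V, hV, this ▸ Set.mem_iInter.1 hy ℓ⟩
  intro A hA f hf hfd hAf
  have hS := hfinN f hf (fun i j h => hfd h)
  set S : ℕ → Set X := fun n => ⋃ i ∈ Finset.range n, f i with hSdef
  have hBm : ∀ n, A ∩ (S n)ᶜ ∈ 𝒜 := fun n => hinter _ hA _ (hcompl _ (hS n).1)
  have hanti : Antitone (fun n => A ∩ (S n)ᶜ) := by
    intro m n hmn
    refine Set.inter_subset_inter_right _ (Set.compl_subset_compl.2 ?_)
    exact Set.biUnion_subset_biUnion_left (fun i hi => by simp at hi ⊢; omega)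
  have hsum : ∀ n, ν A = ∑ i ∈ Finset.range n, ν (f i) + ν (A ∩ (S n)ᶜ) := by
    intro n
    rw [← (hS n).2, ← hadd _ (hS n).1 _ (hBm n)
      (Set.disjoint_left.2 fun x hx hx' => hx'.2 hx)]
    congr 1
    have : S n ⊆ A := by
      rw [hAf]
      exact Set.iUnion₂_subset fun i _ => Set.subset_iUnion f i
    ext x
    by_cases hx : x ∈ S n
    · exact iff_of_true (this hx) (Or.inl hx)
    · exact ⟨fun h => Or.inr ⟨h, hx⟩, fun h => h.elim (fun h => this h) (fun h => h.1)⟩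
  rw [hasSum_iff_tendsto_nat_of_nonneg (fun i => hpos _ (hf i)), Metric.tendsto_atTop]
  intro ε hε
  have : ∃ n, ν (A ∩ (S n)ᶜ) < ε := by
    by_contra hcon
    push Not at hcon
    obtain ⟨y, hy⟩ := hcont _ hBm hanti ε hε hcon
    rw [Set.mem_iInter] at hy
    have hyA := (hy 0).1
    rw [hAf] at hyA
    obtain ⟨i, hi⟩ := Set.mem_iUnion.1 hyA
    exact (hy (i + 1)).2 (Set.mem_biUnion (by simp) hi)
  obtain ⟨N, hN⟩ := this
  refine ⟨N, fun n hn => ?_⟩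
  have a1 := hmono _ (hBm n) _ (hBm N) (hanti hn)
  have a2 := hpos _ (hBm n)
  have a3 := hsum n
  rw [Real.dist_eq, abs_lt]
  constructor <;> linarith
end

section
/- Let R be a ring and let M be a finite R-module which is isomorphic to ∏_{i=1}^{ω} M_i^{n_i}, where M₁,…,M_ω are pairwise non-isomorphic finite simple R-modules and n₁,…,n_ω ≥ 1. Let q_i be the cardinality of the endomorphism field End_R(M_i) (a finite field by Schur's lemma and Wedderburn's theorem). Then the Möbius function of the finite lattice of R-submodules of M satisfies μ(0, M) = ∏_{i=1}^{ω} (−1)^{n_i} q_i^{n_i(n_i−1)/2}. -/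
theorem weisner_aux {L : Type*} [Lattice L] [OrderBot L] [Fintype L] [DecidableEq L]
    (f : L → ℝ)
    (hf : ∀ y : L, ⊥ < y → ∑ᶠ z ∈ Set.Icc ⊥ y, f z = 0) (a : L) (ha : ⊥ < a) :
    ∀ y : L, a ≤ y → ∑ x with x ⊔ a = y, f x = 0 := by
  classical
  intro y
  induction y using WellFoundedLT.induction with
  | ind y ih =>
    intro hay
    have h1 := hf y (lt_of_lt_of_le ha hay)
    have h2 : ∑ x with x ≤ y, f x = 0 := by
      rw [← h1, finsum_mem_eq_sum_filter _ _ (Set.toFinite _)]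
      symm
      apply Finset.sum_subset_zero_on_sdiff
      · intro x hx
        simp at hx ⊢
        exact hx.2
      · intro x hx
        simp at hx
        by_contra h
        tauto
      · intros; rfl
    have h3 : ∑ x with x ≤ y, f x = ∑ z with a ≤ z ∧ z ≤ y, ∑ x with x ⊔ a = z, f x := by
      rw [← Finset.sum_fiberwise_of_maps_to (s := Finset.univ.filter (fun x => x ≤ y))
        (t := Finset.univ.filter (fun z => a ≤ z ∧ z ≤ y)) (g := fun x => x ⊔ a)]
      · apply Finset.sum_congr rfl
        intro z hz
        apply Finset.sum_congr _ (fun _ _ => rfl)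
        ext x
        simp at hz ⊢
        rintro rfl
        exact le_trans le_sup_left hz.2
      · intro x hx
        simp at hx ⊢
        exact ⟨hx, hay⟩
    rw [h2, Finset.sum_eq_single y] at h3
    · exact h3.symm
    · intro z hz hne
      simp at hz
      exact ih z (lt_of_le_of_ne hz.2 hne) hz.1
    · intro h
      simp [hay] at h

theorem mob_step {L : Type*} [Lattice L] [BoundedOrder L] [IsModularLattice L] [Fintype L]
    [DecidableEq L] (f : L → ℝ)
    (hf : ∀ y : L, ⊥ < y → ∑ᶠ z ∈ Set.Icc ⊥ y, f z = 0) (a : L) (ha : IsAtom a)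
    (P : L → Prop) [DecidablePred P] (hP : ∀ x, P x ↔ IsCompl a x) :
    f ⊤ = - ∑ x with P x, f x := by
  have h := weisner_aux f hf a ha.bot_lt ⊤ le_top
  have h2 : Finset.univ.filter (fun x => x ⊔ a = ⊤) =
      insert ⊤ (Finset.univ.filter P) := by
    ext x
    simp only [Finset.mem_filter, Finset.mem_univ, true_and, Finset.mem_insert, hP]
    constructor
    · intro hx
      by_cases hax : a ≤ x
      · left; rw [← hx]; exact (sup_eq_left.2 hax).symm
      · right
        exact ⟨(IsAtom.not_le_iff_disjoint ha).1 hax, codisjoint_iff.2 (by rw [sup_comm]; exact hx)⟩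
    · rintro (rfl | hx)
      · simp
      · rw [sup_comm]; exact hx.sup_eq_top
  rw [h2, Finset.sum_insert] at h
  · linarith
  · simp only [Finset.mem_filter, Finset.mem_univ, true_and, hP]
    intro hx
    have := hx.inf_eq_bot
    rw [inf_top_eq] at this
    exact ha.1 this

theorem card_compl {R : Type*} [Ring R] {M S T : Type*} [AddCommGroup M] [Module R M]
    [AddCommGroup S] [Module R S] [AddCommGroup T] [Module R T]
    (e : M ≃ₗ[R] S × T) (p : Submodule R M) (hp : ∀ m, m ∈ p ↔ (e m).2 = 0) :
    Nat.card {x : Submodule R M // IsCompl p x} = Nat.card (T →ₗ[R] S) := by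
  refine Nat.card_congr ((Submodule.isComplEquivProj p).trans ?_)
  let σ : S →ₗ[R] p := LinearMap.codRestrict p
    (e.symm.toLinearMap.comp (LinearMap.inl R S T)) (fun s => by simp [hp])
  have hσ : ∀ s, e (σ s : M) = (s, 0) := by
    intro s
    change e (e.symm (s, 0)) = (s, 0)
    simp
  refine
    { toFun := fun f => (LinearMap.fst R S T).comp (e.toLinearMap.comp (p.subtype.comp
        (f.1.comp (e.symm.toLinearMap.comp (LinearMap.inr R S T)))))
      invFun := fun g => ⟨σ.comp ((LinearMap.fst R S T + g.comp (LinearMap.snd R S T)).comp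
        e.toLinearMap), ?_⟩
      left_inv := ?_
      right_inv := ?_ }
  · rintro ⟨x, hx⟩
    rw [hp] at hx
    apply Subtype.ext
    apply e.injective
    simp [hσ, hx]
    exact Prod.ext (by simp) (by simp [hx])
  · rintro ⟨f, hf⟩
    apply Subtype.ext
    apply LinearMap.ext
    intro m
    apply Subtype.ext
    apply e.injective
    have h1 : m = (σ (e m).1 : M) + e.symm (0, (e m).2) := by
      apply e.injective
      simp [hσ]
    have h2 := (hp _).1 (f m).2
    refine Prod.ext ?_ ?_
    · conv_rhs => rw [h1, map_add, hf]
      simp [hσ]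
    · simp [hσ, h2]
  · intro g
    ext t
    simp [hσ]

theorem card_hom {R : Type*} [Ring R] {ι : Type*} [DecidableEq ι]
    (Ms : ι → Type*) [∀ i, AddCommGroup (Ms i)] [∀ i, Module R (Ms i)]
    (hsimple : ∀ i, IsSimpleModule R (Ms i))
    (hdist : ∀ i j, i ≠ j → IsEmpty (Ms i ≃ₗ[R] Ms j)) (m : ℕ) (c : Fin m → ι) (i : ι) :
    Nat.card ((∀ k, Ms (c k)) →ₗ[R] Ms i) =
      Nat.card (Module.End R (Ms i)) ^ (Finset.univ.filter (fun k => c k = i)).card := by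
  rw [← Nat.card_congr (LinearMap.lsum R (fun k => Ms (c k)) ℕ).toEquiv, Nat.card_pi,
    Finset.card_filter, ← Finset.prod_pow_eq_pow_sum]
  apply Finset.prod_congr rfl
  intro k _
  split_ifs with h
  · subst h
    simp [Module.End]
  · simp only [pow_zero]
    have := hdist _ _ h
    have : Subsingleton (Ms (c k) →ₗ[R] Ms i) := by
      refine subsingleton_of_forall_eq 0 fun f => ?_
      have := hsimple (c k)
      have := hsimple i
      rcases LinearMap.bijective_or_eq_zero f with h | h
      · exact (IsEmpty.false (LinearEquiv.ofBijective f h)).elim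
      · exact h
    exact Nat.card_unique

theorem mob_main {R : Type*} [Ring R] {ι : Type*} [Fintype ι] [DecidableEq ι]
    (Ms : ι → Type*) [∀ i, AddCommGroup (Ms i)] [∀ i, Module R (Ms i)]
    (hsimple : ∀ i, IsSimpleModule R (Ms i))
    (hdist : ∀ i j, i ≠ j → IsEmpty (Ms i ≃ₗ[R] Ms j)) (m : ℕ) :
    ∀ (c : Fin m → ι) {M : Type*} [AddCommGroup M] [Module R M] [Finite M]
    (e : M ≃ₗ[R] ∀ k, Ms (c k)) (f : Submodule R M → ℝ) (h1 : f ⊥ = 1)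
    (hf : ∀ y, ⊥ < y → ∑ᶠ z ∈ Set.Icc ⊥ y, f z = 0),
    f ⊤ = ∏ i : ι, (-1 : ℝ) ^ (Finset.univ.filter (fun k => c k = i)).card *
      (Nat.card (Module.End R (Ms i)) : ℝ) ^
        ((Finset.univ.filter (fun k => c k = i)).card.choose 2) := by
  induction m with
  | zero =>
    intro c M _ _ _ e f h1 hf
    have : Subsingleton M := e.toEquiv.subsingleton
    rw [← Subsingleton.elim (⊥ : Submodule R M) ⊤, h1]
    simp
  | succ m ih =>
    intro c M _ _ _ e f h1 hf
    classical
    have := Fintype.ofFinite (Submodule R M)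
    let e' : M ≃ₗ[R] Ms (c 0) × ∀ k : Fin m, Ms (c k.succ) :=
      e.trans (Fin.consLinearEquiv R (fun k => Ms (c k))).symm
    let p : Submodule R M := LinearMap.ker ((LinearMap.snd R _ _).comp e'.toLinearMap)
    have hp : ∀ m, m ∈ p ↔ (e' m).2 = 0 := fun m => by simp [p]
    have e2 : (M ⧸ p) ≃ₗ[R] ∀ k : Fin m, Ms (c k.succ) :=
      LinearMap.quotKerEquivOfSurjective _ (by
        intro t; exact ⟨e'.symm (0, t), by simp⟩)
    let e3 : p ≃ₗ[R] Ms (c 0) := LinearEquiv.ofBijective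
      ((LinearMap.fst R _ _).comp (e'.toLinearMap.comp p.subtype)) (by
        constructor
        · intro x y hxy
          apply Subtype.ext
          apply e'.injective
          refine Prod.ext hxy ?_
          rw [(hp _).1 x.2, (hp _).1 y.2]
        · intro s
          exact ⟨⟨e'.symm (s, 0), by simp [hp]⟩, by simp⟩)
    have hatom : IsAtom p := by
      rw [← isSimpleModule_iff_isAtom]
      have := hsimple (c 0)
      exact IsSimpleModule.congr e3
    rw [mob_step f hf p hatom (fun x => IsCompl p x) (fun _ => Iff.rfl)]
    have key : ∀ x, IsCompl p x → f x = ∏ i : ι,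
        (-1 : ℝ) ^ (Finset.univ.filter (fun k : Fin m => c k.succ = i)).card *
        (Nat.card (Module.End R (Ms i)) : ℝ) ^
        ((Finset.univ.filter (fun k : Fin m => c k.succ = i)).card.choose 2) := by
      intro x hx
      have ex : x ≃ₗ[R] ∀ k : Fin m, Ms (c k.succ) :=
        (p.quotientEquivOfIsCompl x hx).symm.trans e2
      have := ih (fun k => c k.succ) ex (fun z => f (z.map x.subtype)) (by simpa using h1) (by
        intro y hy
        rw [← hf (y.map x.subtype) (by
          rw [bot_lt_iff_ne_bot] at hy ⊢
          intro h
          apply hy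
          exact Submodule.map_injective_of_injective x.injective_subtype (by simpa using h))]
        have hinj := Submodule.map_injective_of_injective x.injective_subtype
        rw [← finsum_mem_image (f := f) (g := fun z => Submodule.map x.subtype z) hinj.injOn]
        congr! 3 with z
        simp only [Set.mem_image, Set.mem_Icc, bot_le, true_and]
        constructor
        · rintro ⟨w, hw, rfl⟩
          exact Submodule.map_mono hw
        · intro hz
          refine ⟨z.comap x.subtype, ?_, ?_⟩
          · have := Submodule.comap_mono (f := x.subtype) hz
            rwa [Submodule.comap_map_eq_of_injective x.injective_subtype] at this
          · rw [Submodule.map_comap_subtype]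
            exact inf_eq_right.2 (hz.trans (Submodule.map_subtype_le _ _)))
      simpa using this
    rw [Finset.sum_congr rfl (fun x hx => key x (by simpa using hx)), Finset.sum_const,
      ← Fintype.card_subtype, ← Nat.card_eq_fintype_card, card_compl e' p hp,
      card_hom Ms hsimple hdist m (fun k => c k.succ) (c 0), nsmul_eq_mul]
    rw [← Finset.mul_prod_erase _ _ (Finset.mem_univ (c 0)),
      ← Finset.mul_prod_erase (a := c 0) (s := Finset.univ) _ (Finset.mem_univ (c 0))]
    have hcard : ∀ i, (Finset.univ.filter (fun k => c k = i)).card =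
        (if c 0 = i then 1 else 0) +
          (Finset.univ.filter (fun k : Fin m => c k.succ = i)).card := by
      intro i
      rw [Finset.card_filter, Fin.sum_univ_succ, Finset.card_filter]
    have h0 := hcard (c 0)
    rw [if_pos rfl] at h0
    have hrest : ∀ i ∈ Finset.univ.erase (c 0), (Finset.univ.filter (fun k => c k = i)).card =
          (Finset.univ.filter (fun k : Fin m => c k.succ = i)).card := by
      intro i hi
      rw [hcard, if_neg (Finset.ne_of_mem_erase hi).symm, zero_add]
    rw [Finset.prod_congr rfl (fun i hi => by rw [← hrest i hi]), h0]
    have hch : ∀ k : ℕ, (1 + k).choose 2 = k + k.choose 2 := by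
      intro k
      rw [add_comm 1 k, Nat.choose_succ_succ' k 1, Nat.choose_one_right]
    rw [hch, pow_add, pow_add]
    push_cast
    ring

/-- from Lemmas 3.6/3.7: if a finite `R`-module `M` is
isomorphic to `∏ᵢ Mᵢ^{nᵢ}` with the `Mᵢ` pairwise non-isomorphic finite simple
`R`-modules and `qᵢ = |End_R(Mᵢ)|`, then the Möbius function of the lattice of
submodules of `M` satisfies `μ(0, M) = ∏ᵢ (−1)^{nᵢ} qᵢ^{nᵢ(nᵢ−1)/2}`. -/
theorem statement19 {R : Type*} [Ring R] {M : Type*} [AddCommGroup M] [Module R M]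
    [Finite M] {ι : Type*} [Fintype ι]
    (Ms : ι → Type*) [∀ i, AddCommGroup (Ms i)] [∀ i, Module R (Ms i)]
    (hsimple : ∀ i, IsSimpleModule R (Ms i)) (hfin : ∀ i, Finite (Ms i))
    (hdist : ∀ i j, i ≠ j → IsEmpty (Ms i ≃ₗ[R] Ms j))
    (n : ι → ℕ) (hn : ∀ i, 1 ≤ n i)
    (e : M ≃ₗ[R] ∀ i, Fin (n i) → Ms i)
    (μ : Submodule R M → Submodule R M → ℝ) (hμ : IsMobiusFn μ) :
    μ ⊥ ⊤ = ∏ i : ι,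
      (-1 : ℝ) ^ (n i) * (Nat.card (Module.End R (Ms i)) : ℝ) ^ ((n i).choose 2) := by
  classical
  let E : Fin (Fintype.card (Σ i, Fin (n i))) ≃ (Σ i, Fin (n i)) :=
    (Fintype.equivFin _).symm
  let c : Fin (Fintype.card (Σ i, Fin (n i))) → ι := fun k => (E k).1
  let e1 : M ≃ₗ[R] ∀ k, Ms (c k) := e.trans
    ((LinearEquiv.piCurry R (fun i (_ : Fin (n i)) => Ms i)).symm.trans
      (LinearEquiv.piCongrLeft R (fun s : (Σ i, Fin (n i)) => Ms s.1) E).symm)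
  have h := mob_main Ms hsimple hdist _ c e1 (fun z => μ ⊥ z) (hμ.1 ⊥) (fun y hy => hμ.2 ⊥ y hy)
  have hc : ∀ i, (Finset.univ.filter (fun k => c k = i)).card = n i := by
    intro i
    rw [Finset.card_filter, Equiv.sum_comp E (fun s => if s.1 = i then 1 else 0),
      Fintype.sum_sigma]
    rw [Finset.sum_eq_single i]
    · simp
    · intro b _ hb
      simp [hb]
    · intro h
      exact absurd (Finset.mem_univ i) h
  simp only [hc] at h
  exact h
end
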